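/- arXiv:1207.1927 — 5 statements merged into one kernel-verified Lean document; each statement's English description precedes it below -/
import Mathlib

section
/- Let the puzzle graph be the ring (n-cycle) on n vertices and let the people graph be the Erdős–Rényi random graph G(n, p_n) with p_n = λ/log n for a fixed constant λ ≤ 1/27. Then the probability P_{p_n}(Solve) that the people graph solves the puzzle tends to 0 as n → ∞. -/
open MeasureTheory Filter Topology

namespace Jigsaw

variable {V : Type*}

/-- Two vertex sets are adjacent in the graph `G` if some element of one is
`G`-adjacent to some element of the other. -/
def SetAdj (G : SimpleGraph V) (U W : Set V) : Prop :=
  ∃ u ∈ U, ∃ w ∈ W, G.Adj u w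

/-- The auxiliary graph on the blocks of a collection `C`, joining pairs of distinct
blocks that are both people-adjacent and puzzle-adjacent. -/
def clusterGraph (Gpe Gpu : SimpleGraph V) (C : Set (Set V)) : SimpleGraph C where
  Adj U W := U ≠ W ∧ SetAdj Gpe U.1 W.1 ∧ SetAdj Gpu U.1 W.1
  symm := by
    constructor
    rintro U W ⟨hne, ⟨u, hu, w, hw, ha⟩, ⟨u', hu', w', hw', ha'⟩⟩
    exact ⟨hne.symm, ⟨w, hw, u, hu, ha.symm⟩, ⟨w', hw', u', hu', ha'.symm⟩⟩
  loopless := ⟨fun U h => h.1 rfl⟩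

/-- One step of jigsaw percolation: within each connected component of the cluster
graph, merge all blocks of that component into a single block. -/
def step (Gpe Gpu : SimpleGraph V) (C : Set (Set V)) : Set (Set V) :=
  { S | ∃ cc : (clusterGraph Gpe Gpu C).ConnectedComponent,
      S = ⋃₀ { U : Set V | ∃ h : U ∈ C,
        (clusterGraph Gpe Gpu C).connectedComponentMk ⟨U, h⟩ = cc } }

/-- The partition `C_i` after `i` steps of jigsaw percolation, starting from
singletons. -/
def clusters (Gpe Gpu : SimpleGraph V) : ℕ → Set (Set V)
  | 0 => { S | ∃ v : V, S = {v} }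
  | i + 1 => step Gpe Gpu (clusters Gpe Gpu i)

/-- The people graph `Gpe` solves the puzzle `Gpu`: the process reaches the
partition `{V}`. -/
def Solves (Gpe Gpu : SimpleGraph V) : Prop :=
  ∃ i, clusters Gpe Gpu i = {Set.univ}

/-- `U ⊆ V` is internally solved: jigsaw percolation on `U` with both graphs induced
on `U` ends with the single block `U`. -/
def InternallySolved (Gpe Gpu : SimpleGraph V) (U : Set V) : Prop :=
  Solves (SimpleGraph.induce U Gpe) (SimpleGraph.induce U Gpu)

/-- The graph determined by the Boolean edge indicators `ω`. -/
def graphOf (ω : Sym2 V → Bool) : SimpleGraph V where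
  Adj u v := u ≠ v ∧ ω s(u, v) = true
  symm := by
    constructor
    intro u v h
    exact ⟨h.1.symm, by rw [Sym2.eq_swap]; exact h.2⟩
  loopless := ⟨fun u h => h.1 rfl⟩

/-- The Erdős–Rényi measure: each possible edge appears independently with
probability `p` (the parameter is clamped to `[0,1]`, so for `p ∈ [0,1]` each edge
appears with probability exactly `p`). -/
noncomputable def erMeasure (V : Type*) [Fintype V] [DecidableEq V] (p : ℝ) :
    Measure (Sym2 V → Bool) :=
  Measure.pi fun _ : Sym2 V =>
    (PMF.bernoulli (min (Real.toNNReal p) 1) (min_le_right _ _)).toMeasure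

/-- The ring (`n`-cycle) puzzle graph on `Fin n`. -/
def ringGraph (n : ℕ) : SimpleGraph (Fin n) where
  Adj u v := u ≠ v ∧ (((u : ℕ) + 1) % n = (v : ℕ) ∨ ((v : ℕ) + 1) % n = (u : ℕ))
  symm := ⟨fun u v h => ⟨h.1.symm, h.2.symm⟩⟩
  loopless := ⟨fun u h => h.1 rfl⟩

/-- The ring (`n`-cycle) puzzle graph on `ZMod n`. -/
def zmodRing (n : ℕ) : SimpleGraph (ZMod n) where
  Adj u v := u ≠ v ∧ (u + 1 = v ∨ v + 1 = u)
  symm := ⟨fun u v h => ⟨h.1.symm, h.2.symm⟩⟩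
  loopless := ⟨fun u h => h.1 rfl⟩

/-- The interval of residues `[a, b]` in `ZMod n` is `x`-good with respect to the
people graph `Gpe` if some `u ∈ [a, b]` has no people-edge to any vertex of
`[a - x, b + x]`. -/
def xGood {n : ℕ} (Gpe : SimpleGraph (ZMod n)) (x : ℕ) (a b : ℤ) : Prop :=
  ∃ u : ℤ, a ≤ u ∧ u ≤ b ∧
    ∀ w : ℤ, a - x ≤ w → w ≤ b + x → ¬ Gpe.Adj (u : ZMod n) (w : ZMod n)

/-- The star puzzle graph on `Fin n` with all edges to the last vertex. -/
def starGraph (n : ℕ) : SimpleGraph (Fin n) where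
  Adj u v := u ≠ v ∧ ((u : ℕ) = n - 1 ∨ (v : ℕ) = n - 1)
  symm := ⟨fun u v h => ⟨h.1.symm, h.2.symm⟩⟩
  loopless := ⟨fun u h => h.1 rfl⟩

end Jigsaw

namespace Jigsaw

/-- Arc of length `l` from `a`. -/
def arc (n a l : ℕ) : Finset (Fin n) :=
  Finset.univ.filter (fun x => ∃ j < l, (a + j) % n = (x : ℕ))

lemma mem_arc {n a l : ℕ} {x : Fin n} : x ∈ arc n a l ↔ ∃ j < l, (a + j) % n = (x : ℕ) := by
  simp [arc]

/-- Arc `U` of exact size `l` containing at least `l - 1` people edges. -/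
def Good {n : ℕ} (ω : Sym2 (Fin n) → Bool) (U : Finset (Fin n)) (l : ℕ) : Prop :=
  1 ≤ l ∧ U.card = l ∧ (∃ a < n, U = arc n a l) ∧
    ∃ F ⊆ U.sym2, F.card + 1 = l ∧ ∀ e ∈ F, ω e = true

lemma arc_union {n a b l m : ℕ} (hd : Disjoint (arc n a l) (arc n b m))
    {u w : Fin n} (hu : u ∈ arc n a l) (hw : w ∈ arc n b m)
    (h : ((u : ℕ) + 1) % n = w) : arc n a l ∪ arc n b m = arc n a (l + m) := by
  obtain ⟨i, hi, hiu⟩ := mem_arc.1 hu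
  obtain ⟨j, hj, hjw⟩ := mem_arc.1 hw
  rw [Finset.disjoint_left] at hd
  have h1 : (a + (i + 1)) % n = w := by
    rw [← h, ← hiu, ← add_assoc]; simp
  have hil : i + 1 = l := by
    by_contra hne
    exact hd (mem_arc.2 ⟨i + 1, by omega, h1⟩) hw
  have hj0 : j = 0 := by
    by_contra hne
    obtain ⟨j', rfl⟩ := Nat.exists_eq_succ_of_ne_zero hne
    refine hd hu (mem_arc.2 ⟨j', by omega, ?_⟩)
    have h2 : (a + i) + 1 ≡ (b + j') + 1 [MOD n] := by
      show _ % n = _ % n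
      rw [add_assoc, h1, ← hjw]; rfl
    have h3 := Nat.ModEq.add_right_cancel' 1 h2
    rw [← hiu]; exact h3.symm
  subst hj0
  have h4 : a + l ≡ b [MOD n] := by
    show _ % n = _ % n
    rw [← hil, h1, ← hjw]; rfl
  ext x
  simp only [Finset.mem_union, mem_arc]
  constructor
  · rintro (⟨s, hs, hx⟩ | ⟨s, hs, hx⟩)
    · exact ⟨s, by omega, hx⟩
    · refine ⟨l + s, by omega, ?_⟩
      rw [← hx, ← add_assoc]
      exact h4.add_right s
  · rintro ⟨s, hs, hx⟩
    by_cases hsl : s < l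
    · exact Or.inl ⟨s, hsl, hx⟩
    · obtain ⟨t, rfl⟩ := Nat.exists_eq_add_of_le (not_lt.1 hsl)
      refine Or.inr ⟨t, by omega, ?_⟩
      rw [← hx, ← add_assoc]
      exact (h4.add_right t).symm

lemma good_union_aux {n : ℕ} {ω : Sym2 (Fin n) → Bool} {U W : Finset (Fin n)} {l m : ℕ}
    (hU : Good ω U l) (hW : Good ω W m) (hd : Disjoint U W)
    (hpe : SetAdj (graphOf ω) (U : Set (Fin n)) W)
    {u w : Fin n} (hu : u ∈ U) (hw : w ∈ W) (h : ((u : ℕ) + 1) % n = w) :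
    Good ω (U ∪ W) (l + m) := by
  obtain ⟨h1, hc, ⟨a, ha, rfl⟩, F, hF, hFc, hFo⟩ := hU
  obtain ⟨h1', hc', ⟨b, hb, rfl⟩, F', hF', hFc', hFo'⟩ := hW
  refine ⟨by omega, by rw [Finset.card_union_of_disjoint hd, hc, hc'],
    ⟨a, ha, arc_union hd hu hw h⟩, ?_⟩
  obtain ⟨x, hx, y, hy, hxy⟩ := hpe
  have hx : x ∈ arc n a l := hx
  have hy : y ∈ arc n b m := hy
  have hdl := Finset.disjoint_left.1 hd
  have hdF : Disjoint F F' := by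
    rw [Finset.disjoint_left]
    intro e he he'
    have h1 := hF he
    have h2 := hF' he'
    induction e with
    | _ s t =>
      rw [Finset.mk_mem_sym2_iff] at h1 h2
      exact hdl h1.1 h2.1
  have hnot : s(x, y) ∉ F ∪ F' := by
    intro he
    rcases Finset.mem_union.1 he with he | he
    · have h1 := hF he
      rw [Finset.mk_mem_sym2_iff] at h1
      exact hdl h1.2 hy
    · have h1 := hF' he
      rw [Finset.mk_mem_sym2_iff] at h1
      exact hdl hx h1.1
  refine ⟨insert s(x, y) (F ∪ F'), ?_, ?_, ?_⟩
  · rw [Finset.insert_subset_iff]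
    refine ⟨?_, Finset.union_subset ?_ ?_⟩
    · rw [Finset.mk_mem_sym2_iff]
      exact ⟨Finset.mem_union_left _ hx, Finset.mem_union_right _ hy⟩
    · exact hF.trans (Finset.sym2_mono Finset.subset_union_left)
    · exact hF'.trans (Finset.sym2_mono Finset.subset_union_right)
  · rw [Finset.card_insert_of_notMem hnot, Finset.card_union_of_disjoint hdF]
    omega
  · intro e he
    rcases Finset.mem_insert.1 he with rfl | he
    · exact hxy.2
    · rcases Finset.mem_union.1 he with he | he
      · exact hFo e he
      · exact hFo' e he

lemma SetAdj.symm' {V : Type*} {G : SimpleGraph V} {U W : Set V} (h : SetAdj G U W) :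
    SetAdj G W U := by
  obtain ⟨u, hu, w, hw, h⟩ := h
  exact ⟨w, hw, u, hu, h.symm⟩

lemma good_union {n : ℕ} {ω : Sym2 (Fin n) → Bool} {U W : Finset (Fin n)} {l m : ℕ}
    (hU : Good ω U l) (hW : Good ω W m) (hd : Disjoint U W)
    (hpe : SetAdj (graphOf ω) (U : Set (Fin n)) W)
    (hpu : SetAdj (ringGraph n) (U : Set (Fin n)) W) :
    Good ω (U ∪ W) (l + m) := by
  obtain ⟨u, hu, w, hw, -, h | h⟩ := hpu
  · exact good_union_aux hU hW hd hpe hu hw h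
  · rw [Finset.union_comm, add_comm]
    exact good_union_aux hW hU hd.symm hpe.symm' hw hu h

/-- Fiber of a labelling. -/
def fib {n : ℕ} (f : Fin n → Fin n) (c : Fin n) : Finset (Fin n) :=
  Finset.univ.filter (fun x => f x = c)

lemma mem_fib {n : ℕ} {f : Fin n → Fin n} {c x : Fin n} : x ∈ fib f c ↔ f x = c := by
  simp [fib]

lemma good_singleton {n : ℕ} (ω : Sym2 (Fin n) → Bool) (v : Fin n) : Good ω {v} 1 := by
  refine ⟨le_rfl, by simp, ⟨v, v.2, ?_⟩, ∅, by simp, by simp, by simp⟩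
  ext x
  simp only [Finset.mem_singleton, mem_arc]
  constructor
  · rintro rfl
    exact ⟨0, by omega, by simp [Nat.mod_eq_of_lt x.2]⟩
  · rintro ⟨j, hj, hx⟩
    have : j = 0 := by omega
    subst this
    rw [add_zero, Nat.mod_eq_of_lt v.2] at hx
    exact Fin.ext hx.symm

lemma exists_stable {n k : ℕ} (hk : 2 ≤ k) (ω : Sym2 (Fin n) → Bool)
    (hno : ∀ l, k ≤ l → l < 2 * k → ∀ U, ¬ Good ω U l) :
    ∃ f : Fin n → Fin n, (∀ v, ∃ l < k, Good ω (fib f (f v)) l) ∧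
      ∀ u v, f u ≠ f v →
        SetAdj (graphOf ω) (fib f (f u) : Set (Fin n)) (fib f (f v)) →
        SetAdj (ringGraph n) (fib f (f u) : Set (Fin n)) (fib f (f v)) → False := by
  classical
  obtain ⟨f, hf, hmin⟩ := Set.exists_min_image
    {f : Fin n → Fin n | ∀ v, ∃ l < k, Good ω (fib f (f v)) l}
    (fun f => (Finset.univ.image f).card) (Set.toFinite _)
    ⟨id, fun v => ⟨1, by omega, by
      have : fib id (id v) = ({v} : Finset (Fin n)) := by ext x; simp [mem_fib]
      rw [this]; exact good_singleton ω v⟩⟩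
  refine ⟨f, hf, fun u v huv hpe hpu => ?_⟩
  obtain ⟨l, hl, hgl⟩ := hf u
  obtain ⟨m, hm, hgm⟩ := hf v
  have hd : Disjoint (fib f (f u)) (fib f (f v)) := by
    rw [Finset.disjoint_left]
    intro x h1 h2
    rw [mem_fib] at h1 h2
    exact huv (h1.symm.trans h2)
  have hg := good_union hgl hgm hd hpe hpu
  have hlm : l + m < k := by
    by_contra h
    exact hno (l + m) (by omega) (by omega) _ hg
  let g : Fin n → Fin n := fun x => if f x = f v then f u else f x
  have hgv : ∀ x, g x ≠ f v := by
    intro x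
    by_cases h : f x = f v
    · simp [g, h, huv]
    · simp [g, h]
  have hgood : ∀ x, ∃ l < k, Good ω (fib g (g x)) l := by
    intro x
    by_cases hx : g x = f u
    · refine ⟨l + m, hlm, ?_⟩
      have : fib g (g x) = fib f (f u) ∪ fib f (f v) := by
        ext y
        rw [hx, Finset.mem_union, mem_fib, mem_fib, mem_fib]
        by_cases h : f y = f v
        · simp [g, h]
        · simp [g, h]
      rw [this]; exact hg
    · have hxv : f x ≠ f v := fun h => hx (by simp [g, h])
      have hgx : g x = f x := by simp [g, hxv]
      obtain ⟨r, hr, hgr⟩ := hf x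
      refine ⟨r, hr, ?_⟩
      have : fib g (g x) = fib f (f x) := by
        ext y
        rw [mem_fib, mem_fib, hgx]
        by_cases h : f y = f v
        · have h1 : g y = f u := by simp [g, h]
          rw [h1, h]
          rw [hgx] at hx
          exact ⟨fun h => absurd h.symm hx, fun h => absurd h.symm hxv⟩
        · simp [g, h]
      rw [this]; exact hgr
  have h1 := hmin g hgood
  have h2 : (Finset.univ.image g).card < (Finset.univ.image f).card := by
    apply Finset.card_lt_card
    rw [Finset.ssubset_iff_of_subset]
    · refine ⟨f v, by simp, ?_⟩
      intro h
      obtain ⟨x, -, hx⟩ := Finset.mem_image.1 h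
      exact hgv x hx
    · intro y hy
      obtain ⟨x, -, rfl⟩ := Finset.mem_image.1 hy
      by_cases h : f x = f v
      · simp [g, h]
      · simp [g, h]
  exact absurd h1 (not_le.2 h2)

lemma clusters_sub {n : ℕ} (ω : Sym2 (Fin n) → Bool) (f : Fin n → Fin n)
    (hf : ∀ u v, f u ≠ f v →
        SetAdj (graphOf ω) (fib f (f u) : Set (Fin n)) (fib f (f v)) →
        SetAdj (ringGraph n) (fib f (f u) : Set (Fin n)) (fib f (f v)) → False) (i : ℕ) :
    ∀ S ∈ clusters (graphOf ω) (ringGraph n) i, ∀ x ∈ S, ∀ y ∈ S, f x = f y := by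
  induction i with
  | zero =>
    rintro S ⟨v, rfl⟩ x hx y hy
    rw [Set.mem_singleton_iff.1 hx, Set.mem_singleton_iff.1 hy]
  | succ i ih =>
    rintro S ⟨cc, rfl⟩ x ⟨U, ⟨hU, hUc⟩, hx⟩ y ⟨W, ⟨hW, hWc⟩, hy⟩
    have hr := SimpleGraph.ConnectedComponent.exact (hUc.trans hWc.symm)
    obtain ⟨p⟩ := hr
    have key : ∀ (A B : (clusters (graphOf ω) (ringGraph n) i))
        (p : (clusterGraph (graphOf ω) (ringGraph n)
          (clusters (graphOf ω) (ringGraph n) i)).Walk A B),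
        ∀ x ∈ A.1, ∀ y ∈ B.1, f x = f y := by
      intro A B p
      induction p with
      | nil => exact ih _ (Subtype.prop _)
      | @cons A A' B h p ihp =>
        intro x hx y hy
        obtain ⟨-, ⟨u, hu, w, hw, h1⟩, ⟨u', hu', w', hw', h2⟩⟩ := h
        have e1 := ih _ A.2 x hx u hu
        have e1' := ih _ A.2 u' hu' u hu
        have e2' := ih _ A'.2 w' hw' w hw
        have e3 := ihp w hw y hy
        rw [e1, ← e3]
        by_contra hne
        refine hf u w hne ⟨u, ?_, w, ?_, h1⟩ ⟨u', ?_, w', ?_, h2⟩ <;>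
          simp [mem_fib, e1', e2']
    exact key _ _ p x hx y hy

lemma solves_good {n k : ℕ} (hk : 2 ≤ k) (hkn : k ≤ n) (ω : Sym2 (Fin n) → Bool)
    (hs : Solves (graphOf ω) (ringGraph n)) :
    ∃ l, k ≤ l ∧ l < 2 * k ∧ ∃ U, Good ω U l := by
  by_contra hcon
  push Not at hcon
  obtain ⟨f, h1, h2⟩ := exists_stable hk ω hcon
  obtain ⟨i, hi⟩ := hs
  have h3 := clusters_sub ω f h2 i Set.univ (by rw [hi]; rfl)
  obtain ⟨l, hl, hg⟩ := h1 ⟨0, by omega⟩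
  have : fib f (f ⟨0, by omega⟩) = Finset.univ := by
    ext x
    simp only [mem_fib, Finset.mem_univ, iff_true]
    exact h3 _ trivial _ trivial
  have hc := hg.2.1
  rw [this, Finset.card_univ, Fintype.card_fin] at hc
  omega

lemma prob_F {V : Type*} [Fintype V] [DecidableEq V] (p : ℝ) (F : Finset (Sym2 V)) :
    erMeasure V p {ω | ∀ e ∈ F, ω e = true} ≤ (ENNReal.ofReal p) ^ F.card := by
  have h : {ω : Sym2 V → Bool | ∀ e ∈ F, ω e = true} =
      Set.univ.pi (fun e => if e ∈ F then {true} else Set.univ) := by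
    ext ω
    simp only [Set.mem_setOf_eq, Set.mem_pi, Set.mem_univ, true_imp_iff]
    refine forall_congr' fun e => ?_
    by_cases he : e ∈ F <;> simp [he]
  rw [h, erMeasure, Measure.pi_pi, ← Finset.prod_const]
  rw [← Finset.prod_subset (Finset.subset_univ F)]
  · refine Finset.prod_le_prod' fun e he => ?_
    rw [if_pos he, PMF.toMeasure_apply_singleton _ _ (by measurability)]
    rw [PMF.bernoulli_apply]
    simp [ENNReal.ofReal]
  · intro e _ he
    rw [if_neg he, measure_univ]

lemma prob_good (n l : ℕ) (p : ℝ) :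
    erMeasure (Fin n) p {ω | ∃ U, Good ω U l} ≤
      n * (((l + 1).choose 2).choose (l - 1) * (ENNReal.ofReal p) ^ (l - 1)) := by
  classical
  set B := ((Finset.range n).image (fun a => arc n a l)).filter (fun U => U.card = l) with hB
  have hBc : B.card ≤ n := (Finset.card_filter_le _ _).trans
    (Finset.card_image_le.trans (by simp))
  have hsub : {ω | ∃ U, Good ω U l} ⊆ ⋃ U ∈ B, ⋃ F ∈ U.sym2.powersetCard (l - 1),
      {ω : Sym2 (Fin n) → Bool | ∀ e ∈ F, ω e = true} := by
    rintro ω ⟨U, h1, hc, ⟨a, ha, hU⟩, F, hF, hFc, hFo⟩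
    simp only [Set.mem_iUnion]
    refine ⟨U, ?_, F, ?_, hFo⟩
    · rw [hB, Finset.mem_filter, Finset.mem_image]
      exact ⟨⟨a, Finset.mem_range.2 ha, hU.symm⟩, hc⟩
    · rw [Finset.mem_powersetCard]
      exact ⟨hF, by omega⟩
  refine (measure_mono hsub).trans ((measure_biUnion_finset_le _ _).trans ?_)
  calc _ ≤ ∑ U ∈ B, ((((l + 1).choose 2).choose (l - 1) : ℕ) : ENNReal) *
        (ENNReal.ofReal p) ^ (l - 1) := by
        refine Finset.sum_le_sum fun U hU => ?_
        have hc : U.card = l := (Finset.mem_filter.1 hU).2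
        refine (measure_biUnion_finset_le _ _).trans ?_
        calc _ ≤ ∑ F ∈ U.sym2.powersetCard (l - 1), (ENNReal.ofReal p) ^ (l - 1) := by
              refine Finset.sum_le_sum fun F hF => ?_
              rw [← (Finset.mem_powersetCard.1 hF).2]
              exact prob_F p F
          _ = _ := by
              rw [Finset.sum_const, Finset.card_powersetCard, Finset.card_sym2, hc, nsmul_eq_mul]
    _ ≤ _ := by
        rw [Finset.sum_const, nsmul_eq_mul]
        gcongr

end Jigsaw

namespace Jigsaw

lemma real_bound (r : ℕ) (hr : 2 ≤ r) (p : ℝ) (hp : 0 ≤ p)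
    (h : Real.exp 1 * p * ((r + 4) / 2) ≤ Real.exp (-2)) :
    ((((r + 2).choose 2).choose r : ℕ) : ℝ) * p ^ r ≤ Real.exp (-2 * r) := by
  have hr' : (2 : ℝ) ≤ r := by exact_mod_cast hr
  have hm : (((r + 2).choose 2 : ℕ) : ℝ) ≤ r * ((r + 4) / 2) := by
    rw [Nat.cast_choose_two]
    push_cast
    nlinarith
  have h1 : ((((r + 2).choose 2).choose r : ℕ) : ℝ) ≤
      (((r + 2).choose 2 : ℕ) : ℝ) ^ r / (r.factorial : ℝ) := Nat.choose_le_pow_div r _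
  have h2 : (r : ℝ) ^ r / (r.factorial : ℝ) ≤ Real.exp 1 ^ r := by
    rw [← Real.exp_nat_mul, mul_one]
    exact Real.pow_div_factorial_le_exp r (by positivity) r
  calc ((((r + 2).choose 2).choose r : ℕ) : ℝ) * p ^ r
      ≤ ((r * ((r + 4) / 2)) ^ r / (r.factorial : ℝ)) * p ^ r := by
        gcongr
        exact h1.trans (by gcongr)
    _ = ((r : ℝ) ^ r / (r.factorial : ℝ)) * (p * ((r + 4) / 2)) ^ r := by
        rw [mul_pow, mul_pow]; ring
    _ ≤ Real.exp 1 ^ r * (p * ((r + 4) / 2)) ^ r := by gcongr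
    _ = (Real.exp 1 * p * ((r + 4) / 2)) ^ r := by rw [← mul_pow, mul_assoc]
    _ ≤ Real.exp (-2) ^ r := by gcongr
    _ = Real.exp (-2 * r) := by rw [← Real.exp_nat_mul]; ring_nf

lemma exp_bound (L x : ℝ) (hL : 10 ≤ L) (hx : 0 ≤ x) (hx' : x ≤ 2 * L + 4) :
    Real.exp 1 * (1 / 27 / L) * (x / 2) ≤ Real.exp (-2) := by
  have he := Real.exp_one_lt_d9
  have h3 : Real.exp 1 * Real.exp 2 ≤ 20.1 := by
    have : Real.exp 2 = Real.exp 1 * Real.exp 1 := by rw [← Real.exp_add]; norm_num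
    rw [this]
    have h0 := Real.exp_pos 1
    calc Real.exp 1 * (Real.exp 1 * Real.exp 1)
        ≤ 2.7182818286 * (2.7182818286 * 2.7182818286) := by gcongr
      _ ≤ 20.1 := by norm_num
  rw [Real.exp_neg, ← one_div, le_div_iff₀ (Real.exp_pos 2)]
  have : Real.exp 1 * (1 / 27 / L) * (x / 2) * Real.exp 2 =
    (Real.exp 1 * Real.exp 2) * (x / (54 * L)) := by field_simp; ring
  rw [this]
  have h4 : x / (54 * L) ≤ 24 / 540 := by
    rw [div_le_iff₀ (by linarith)]; linarith
  calc (Real.exp 1 * Real.exp 2) * (x / (54 * L)) ≤ 20.1 * (24 / 540) := by gcongr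
    _ ≤ 1 := by norm_num

lemma main_bound (lam : ℝ) (hlam : lam ≤ 1 / 27) (n : ℕ) (hn : 10 ≤ Real.log n) :
    erMeasure (Fin n) (lam / Real.log n) {ω | Solves (graphOf ω) (ringGraph n)} ≤
      ENNReal.ofReal ((Real.log n + 1) * Real.exp (2 - Real.log n)) := by
  set L := Real.log n with hL
  have hn0 : (0 : ℝ) < n := by
    rcases Nat.eq_zero_or_pos n with h | h
    · subst h; simp at hL; linarith
    · exact_mod_cast h
  have hnL : Real.exp L = n := Real.exp_log hn0
  set k := ⌈L⌉₊ with hk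
  have hk1 : L ≤ k := Nat.le_ceil L
  have hk2 : (k : ℝ) < L + 1 := Nat.ceil_lt_add_one (by linarith)
  have hk10 : 10 ≤ k := by
    have : (10 : ℝ) ≤ k := by linarith
    exact_mod_cast this
  have hkn : k ≤ n := by
    have h1 := Real.add_one_le_exp L
    have : (k : ℝ) ≤ n := by linarith
    exact_mod_cast this
  have hsub : {ω | Solves (graphOf ω) (ringGraph n)} ⊆
      ⋃ l ∈ Finset.Ico k (2 * k), {ω : Sym2 (Fin n) → Bool | ∃ U, Good ω U l} := by
    intro ω hω
    obtain ⟨l, h1, h2, h3⟩ := solves_good (by omega) hkn ω hω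
    simp only [Set.mem_iUnion]
    exact ⟨l, Finset.mem_Ico.2 ⟨h1, h2⟩, h3⟩
  refine (measure_mono hsub).trans ((measure_biUnion_finset_le _ _).trans ?_)
  have hterm : ∀ l ∈ Finset.Ico k (2 * k),
      erMeasure (Fin n) (lam / L) {ω | ∃ U, Good ω U l} ≤
        ENNReal.ofReal (n * Real.exp (2 - 2 * L)) := by
    intro l hl
    rw [Finset.mem_Ico] at hl
    refine (prob_good n l _).trans ?_
    obtain ⟨r, rfl⟩ : ∃ r, l = r + 1 := ⟨l - 1, by omega⟩
    simp only [Nat.add_sub_cancel]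
    have hp : (0 : ℝ) ≤ 1 / 27 / L := by positivity
    have hrk : (k : ℝ) ≤ r + 1 := by exact_mod_cast hl.1
    have hrk2 : (r : ℝ) + 2 ≤ 2 * k := by exact_mod_cast (by omega : r + 2 ≤ 2 * k)
    have hb := real_bound r (by omega) (1 / 27 / L) hp
      (exp_bound L (r + 4) hn (by positivity) (by linarith))
    have hb2 : ((((r + 2).choose 2).choose r : ℕ) : ℝ) * (1 / 27 / L) ^ r
        ≤ Real.exp (2 - 2 * L) := hb.trans (Real.exp_le_exp.2 (by linarith))
    have hle : ENNReal.ofReal (lam / L) ≤ ENNReal.ofReal (1 / 27 / L) :=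
      ENNReal.ofReal_le_ofReal (by gcongr)
    calc _ ≤ (n : ENNReal) * (((r + 1 + 1).choose 2).choose r *
          (ENNReal.ofReal (1 / 27 / L)) ^ r) := by gcongr
      _ = ENNReal.ofReal (n * (((((r + 2).choose 2).choose r : ℕ) : ℝ) * (1 / 27 / L) ^ r)) := by
          rw [ENNReal.ofReal_mul hn0.le, ENNReal.ofReal_mul (by positivity),
            ENNReal.ofReal_pow hp, ENNReal.ofReal_natCast, ENNReal.ofReal_natCast]
      _ ≤ _ := ENNReal.ofReal_le_ofReal (by gcongr)
  refine (Finset.sum_le_sum hterm).trans ?_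
  rw [Finset.sum_const, nsmul_eq_mul, Nat.card_Ico, ← ENNReal.ofReal_natCast,
    ← ENNReal.ofReal_mul (by positivity)]
  apply ENNReal.ofReal_le_ofReal
  have h5 : (n : ℝ) * Real.exp (2 - 2 * L) = Real.exp (2 - L) := by
    rw [← hnL, ← Real.exp_add]; ring_nf
  rw [h5]
  have h6 : 2 * k - k = k := by omega
  rw [h6]
  gcongr

end Jigsaw



open MeasureTheory Filter Topology

/-- For the ring (`n`-cycle) puzzle and an Erdős–Rényi people graph
with `p_n = λ / log n`, `λ ≤ 1/27`, the probability of solving tends to `0`. -/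
theorem jigsaw_ring_lower (lam : ℝ) (hlam : lam ≤ 1 / 27) :
    Tendsto
      (fun n : ℕ =>
        Jigsaw.erMeasure (Fin n) (lam / Real.log n)
          {ω | Jigsaw.Solves (Jigsaw.graphOf ω) (Jigsaw.ringGraph n)})
      atTop (𝓝 0) := by
  have hlog : Tendsto (fun n : ℕ => Real.log n) atTop atTop :=
    Real.tendsto_log_atTop.comp tendsto_natCast_atTop_atTop
  have hg : Tendsto (fun x : ℝ => (x + 1) * Real.exp (2 - x)) atTop (𝓝 0) := by
    have h1 := Real.tendsto_pow_mul_exp_neg_atTop_nhds_zero 1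
    have h0 := Real.tendsto_pow_mul_exp_neg_atTop_nhds_zero 0
    have h2 := (h1.add h0).const_mul (Real.exp 2)
    rw [add_zero, mul_zero] at h2
    refine h2.congr fun x => ?_
    rw [sub_eq_add_neg, Real.exp_add]
    ring
  have hb := ENNReal.tendsto_ofReal (hg.comp hlog)
  rw [ENNReal.ofReal_zero] at hb
  refine tendsto_of_tendsto_of_tendsto_of_le_of_le' tendsto_const_nhds hb
    (Eventually.of_forall fun _ => zero_le) ?_
  filter_upwards [hlog.eventually_ge_atTop 10] with n hn
  exact Jigsaw.main_bound lam hlam n hn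
end

section
/- Fix D ≥ 1. Let the puzzle graphs be any sequence of connected simple graphs on n vertices whose maximum degree is at most D for all n, and let the people graph be the Erdős–Rényi random graph G(n,p). Then the critical value satisfies: (i) there is a constant C such that p_c(n) ≤ C/log n for all sufficiently large n, and (ii) for every b > 0, n^b · p_c(n) → ∞ as n → ∞. -/
open MeasureTheory Filter Topology

namespace Jigsaw

section partA
variable {V : Type*} {Gpe Gpu : SimpleGraph V}

lemma clusters_cover (i : ℕ) (v : V) : ∃ U ∈ clusters Gpe Gpu i, v ∈ U := by
  induction i with
  | zero => exact ⟨{v}, ⟨v, rfl⟩, rfl⟩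
  | succ i ih =>
    obtain ⟨U, hU, hv⟩ := ih
    exact ⟨_, ⟨(clusterGraph Gpe Gpu (clusters Gpe Gpu i)).connectedComponentMk ⟨U, hU⟩, rfl⟩,
      Set.mem_sUnion.2 ⟨U, ⟨hU, rfl⟩, hv⟩⟩

lemma clusters_disj (i : ℕ) : ∀ U ∈ clusters Gpe Gpu i, ∀ W ∈ clusters Gpe Gpu i,
    ∀ v, v ∈ U → v ∈ W → U = W := by
  induction i with
  | zero =>
    rintro U ⟨u, rfl⟩ W ⟨w, rfl⟩ v hu hw
    rw [Set.mem_singleton_iff] at hu hw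
    rw [← hu, ← hw]
  | succ i ih =>
    rintro U ⟨c, rfl⟩ W ⟨d, rfl⟩ v hu hw
    obtain ⟨A, ⟨hA, hAc⟩, hvA⟩ := hu
    obtain ⟨B, ⟨hB, hBd⟩, hvB⟩ := hw
    obtain rfl := ih A hA B hB v hvA hvB
    rw [← hAc, ← hBd]

lemma clusters_nonempty (i : ℕ) : ∀ U ∈ clusters Gpe Gpu i, U.Nonempty := by
  induction i with
  | zero => rintro U ⟨u, rfl⟩; exact ⟨u, rfl⟩
  | succ i ih =>
    rintro U ⟨c, rfl⟩
    induction c using SimpleGraph.ConnectedComponent.ind with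
    | h A =>
      obtain ⟨v, hv⟩ := ih A.1 A.2
      exact ⟨v, A.1, ⟨A.2, rfl⟩, hv⟩

/-- `T` is contained in a single block at some time. -/
def InOne (Gpe Gpu : SimpleGraph V) (T : Set V) : Prop :=
  ∃ i, ∃ U ∈ clusters Gpe Gpu i, T ⊆ U

lemma inOne_singleton (v : V) : InOne Gpe Gpu {v} := ⟨0, {v}, ⟨v, rfl⟩, subset_rfl⟩

lemma InOne.insert {T : Set V} (h : InOne Gpe Gpu T) (w : V)
    (h1 : ∃ u ∈ T, Gpe.Adj u w) (h2 : ∃ u ∈ T, Gpu.Adj u w) : InOne Gpe Gpu (insert w T) := by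
  obtain ⟨i, U, hU, hTU⟩ := h
  obtain ⟨W, hW, hwW⟩ := clusters_cover (Gpe := Gpe) (Gpu := Gpu) i w
  refine ⟨i + 1, _, ⟨(clusterGraph Gpe Gpu (clusters Gpe Gpu i)).connectedComponentMk ⟨U, hU⟩, rfl⟩,
    ?_⟩
  intro x hx
  rcases hx with rfl | hx
  · refine ⟨W, ⟨hW, ?_⟩, hwW⟩
    by_cases hne : W = U
    · subst hne; rfl
    · rw [SimpleGraph.ConnectedComponent.eq]
      apply SimpleGraph.Adj.reachable
      obtain ⟨u, hu, ha⟩ := h1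
      obtain ⟨u', hu', ha'⟩ := h2
      exact ⟨fun h => hne (congrArg Subtype.val h), ⟨x, hwW, u, hTU hu, ha.symm⟩,
        ⟨x, hwW, u', hTU hu', ha'.symm⟩⟩
  · exact ⟨U, ⟨hU, rfl⟩, hTU hx⟩

lemma InOne.solves (h : InOne Gpe Gpu Set.univ) : Solves Gpe Gpu := by
  obtain ⟨i, U, hU, hTU⟩ := h
  obtain rfl : U = Set.univ := Set.univ_subset_iff.1 hTU
  refine ⟨i, ?_⟩
  ext W
  constructor
  · intro hW
    obtain ⟨v, hv⟩ := clusters_nonempty i W hW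
    exact clusters_disj i W hW _ hU v hv trivial
  · rintro rfl; exact hU

lemma InOne.solves_of_grow [Finite V] {T : Set V} (hT : T.Nonempty) (h : InOne Gpe Gpu T)
    (hc : Gpu.Connected) (hg : ∀ v, v ∉ T → ∃ u ∈ T, Gpe.Adj u v) : Solves Gpe Gpu := by
  classical
  have hfin : {S : Set V | T ⊆ S ∧ InOne Gpe Gpu S}.Finite := Set.toFinite _
  obtain ⟨S, hS⟩ := hfin.exists_maximal ⟨T, subset_rfl, h⟩
  have huniv : S = Set.univ := by
    by_contra hne
    obtain ⟨x, hx⟩ := hT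
    obtain ⟨y, hy⟩ := (Set.ne_univ_iff_exists_notMem S).1 hne
    obtain ⟨w⟩ := hc.preconnected x y
    obtain ⟨d, hd, hd1, hd2⟩ := w.exists_boundary_dart S (hS.prop.1 hx) hy
    obtain ⟨u, hu, ha⟩ := hg d.snd (fun h => hd2 (hS.prop.1 h))
    have := hS.prop.2.insert d.snd ⟨u, hS.prop.1 hu, ha⟩ ⟨d.fst, hd1, d.adj⟩
    have h2 := hS.le_of_ge ⟨hS.prop.1.trans (Set.subset_insert _ _), this⟩ (Set.subset_insert _ _)
    exact hd2 (h2 (Set.mem_insert _ _))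
  rw [huniv] at hS
  exact hS.prop.2.solves

end partA

end Jigsaw

namespace Jigsaw

section partB
variable {V : Type*}

/-- Each entry of the list is related to some later entry of the list. -/
def Chain (r : V → V → Prop) : List V → Prop
  | [] => True
  | w :: L => (L = [] ∨ ∃ x ∈ L, r x w) ∧ Chain r L

lemma Chain.inOne {ω : Sym2 V → Bool} {G : SimpleGraph V} : ∀ {L : List V}, L.Nodup → L ≠ [] →
    Chain (fun u v => ω s(u, v) = true) L → Chain G.Adj L → InOne (graphOf ω) G {x | x ∈ L}
  | [], _, h, _, _ => absurd rfl h
  | w :: L, hn, _, h1, h2 => by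
    rw [List.nodup_cons] at hn
    by_cases hL : L = []
    · subst hL
      simpa using inOne_singleton (Gpe := graphOf ω) (Gpu := G) w
    · have ih := Chain.inOne hn.2 hL h1.2 h2.2
      obtain ⟨x, hx, hxw⟩ := h1.1.resolve_left hL
      obtain ⟨y, hy, hyw⟩ := h2.1.resolve_left hL
      have := ih.insert w ⟨x, hx, fun h => hn.1 (h ▸ hx), hxw⟩ ⟨y, hy, hyw⟩
      convert this using 1
      ext z; simp

variable [Fintype V] [DecidableEq V]

instance erMeasure_prob (p : ℝ) : IsProbabilityMeasure (erMeasure V p) := by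
  unfold erMeasure; infer_instance

lemma er_open {p : ℝ} (h0 : 0 ≤ p) (h1 : p ≤ 1) (F : Finset (Sym2 V)) :
    (erMeasure V p).real {ω | ∀ e ∈ F, ω e = true} = p ^ F.card := by
  have : {ω : Sym2 V → Bool | ∀ e ∈ F, ω e = true} = Set.pi (F : Set (Sym2 V)) (fun _ => {true}) := by
    ext; simp [Set.mem_pi]
  rw [this, Measure.real, erMeasure, Measure.pi_pi_finset]
  have hp : min p.toNNReal 1 = p.toNNReal := min_eq_left (by simpa using h1)
  simp [PMF.toMeasure_apply_singleton, PMF.bernoulli_apply, hp, h0]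

lemma er_closed {p : ℝ} (h0 : 0 ≤ p) (h1 : p ≤ 1) (F : Finset (Sym2 V)) :
    (erMeasure V p).real {ω | ∀ e ∈ F, ω e = false} = (1 - p) ^ F.card := by
  have : {ω : Sym2 V → Bool | ∀ e ∈ F, ω e = false} = Set.pi (F : Set (Sym2 V)) (fun _ => {false}) := by
    ext; simp [Set.mem_pi]
  rw [this, Measure.real, erMeasure, Measure.pi_pi_finset]
  have hp : min p.toNNReal 1 = p.toNNReal := min_eq_left (by simpa using h1)
  have h2 : p.toNNReal ≤ 1 := by simpa using h1
  have h3 : (1 - ENNReal.ofReal p).toReal = 1 - p := by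
    rw [ENNReal.toReal_sub_of_le (by simpa using h1) (by simp), ENNReal.toReal_ofReal h0]; simp
  simp [PMF.toMeasure_apply_singleton, PMF.bernoulli_apply, hp]
  rw [← h3]; rfl

/-- The event `A` only depends on the coordinates in `S`. -/
def DetBy (S : Finset (Sym2 V)) (A : Set (Sym2 V → Bool)) : Prop :=
  ∀ ω ω', (∀ e ∈ S, ω e = ω' e) → ω ∈ A → ω' ∈ A

lemma er_indep (p : ℝ) {S T : Finset (Sym2 V)} (hST : Disjoint S T) {A B : Set (Sym2 V → Bool)}
    (hA : DetBy S A) (hB : DetBy T B) :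
    (erMeasure V p).real (A ∩ B) = (erMeasure V p).real A * (erMeasure V p).real B := by
  have hi : ProbabilityTheory.iIndepFun (fun (e : Sym2 V) (ω : Sym2 V → Bool) => ω e)
      (erMeasure V p) :=
    ProbabilityTheory.iIndepFun_pi (X := fun _ b => b) (fun i => aemeasurable_id)
  have h := hi.indepFun_finset S T hST (fun i => measurable_pi_apply i)
  have key : ∀ (S : Finset (Sym2 V)) (A : Set (Sym2 V → Bool)), DetBy S A →
      A = (fun (ω : Sym2 V → Bool) (i : S) => ω i) ⁻¹' ((fun (ω : Sym2 V → Bool) (i : S) => ω i) '' A) := by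
    intro S A hA
    apply subset_antisymm (Set.subset_preimage_image _ _)
    rintro ω ⟨ω', h', he⟩
    exact hA ω' ω (fun e he' => congrFun he ⟨e, he'⟩) h'
  have := h.measure_inter_preimage_eq_mul _ _
    (Set.toFinite ((fun (ω : Sym2 V → Bool) (i : S) => ω i) '' A)).measurableSet
    (Set.toFinite ((fun (ω : Sym2 V → Bool) (i : T) => ω i) '' B)).measurableSet
  rw [← key S A hA, ← key T B hB] at this
  simp only [Measure.real, this, ENNReal.toReal_mul]

lemma chain_detBy : ∀ (L : List V), DetBy L.toFinset.sym2
    {ω | Chain (fun u v => ω s(u, v) = true) L}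
  | [] => fun _ _ _ _ => trivial
  | w :: L => by
    rintro ω ω' he ⟨h1, h2⟩
    refine ⟨?_, chain_detBy L ω ω' (fun e hE => he e ?_) h2⟩
    · rcases h1 with h1 | ⟨x, hx, h⟩
      · exact Or.inl h1
      · refine Or.inr ⟨x, hx, ?_⟩
        have := he s(x, w) (by simp [hx])
        exact this.symm.trans h
    · exact Finset.sym2_mono (by intro z hz; simp at hz ⊢; exact Or.inr hz) hE

lemma chain_prob {p : ℝ} (h0 : 0 ≤ p) (h1 : p ≤ 1) : ∀ (L : List V), L.Nodup →
    (erMeasure V p).real {ω | Chain (fun u v => ω s(u, v) = true) L} =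
      ∏ j ∈ Finset.range (L.length - 1), (1 - (1 - p) ^ (j + 1))
  | [], _ => by simp [Chain]
  | [w], _ => by simp [Chain]
  | w :: u :: L, hn => by
    rw [List.nodup_cons] at hn
    have ih := chain_prob h0 h1 (u :: L) hn.2
    set M := u :: L with hM
    have hMl : M.length = L.length + 1 := rfl
    set F : Finset (Sym2 V) := M.toFinset.image (fun x => s(x, w)) with hF
    have hcard : F.card = M.length := by
      rw [hF, Finset.card_image_of_injective _ (fun a b h => Sym2.congr_left.1 h),
        List.toFinset_card_of_nodup hn.2]
    have hA : {ω : Sym2 V → Bool | Chain (fun u v => ω s(u, v) = true) (w :: M)} =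
        {ω | ∀ e ∈ F, ω e = false}ᶜ ∩ {ω | Chain (fun u v => ω s(u, v) = true) M} := by
      ext ω
      have hMne : M ≠ [] := by simp [hM]
      have : (∃ x ∈ M, ω s(x, w) = true) ↔ ¬ ∀ e ∈ F, ω e = false := by
        simp [hF]
      simp only [Chain, hMne, false_or, Set.mem_setOf_eq, Set.mem_inter_iff, Set.mem_compl_iff, this]
    have hdis : Disjoint F M.toFinset.sym2 := by
      rw [Finset.disjoint_left]
      intro e he he2
      obtain ⟨x, hx, rfl⟩ := Finset.mem_image.1 he
      simp at he2
      exact hn.1 he2.2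
    have hdF : DetBy F ({ω | ∀ e ∈ F, ω e = false}ᶜ : Set (Sym2 V → Bool)) := by
      intro ω ω' he h h'
      exact h fun e hE => by rw [he e hE]; exact h' e hE
    rw [hA, er_indep p hdis hdF (chain_detBy M), ih, measureReal_compl (Set.toFinite _).measurableSet,
      er_closed h0 h1, hcard]
    simp only [List.length_cons, hMl, Nat.add_sub_cancel, Finset.prod_range_succ, probReal_univ]
    ring

lemma blocks_prob {p a : ℝ} (h0 : 0 ≤ p) (h1 : p ≤ 1) (ha : a ≤ 1) : ∀ (B : List (List V)),
    B.Pairwise List.Disjoint →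
    (∀ L ∈ B, a ≤ (erMeasure V p).real {ω | Chain (fun u v => ω s(u, v) = true) L}) →
    (erMeasure V p).real {ω | ∀ L ∈ B, ¬ Chain (fun u v => ω s(u, v) = true) L} ≤ (1 - a) ^ B.length
  | [], _, _ => by simp
  | L :: B, hd, hp => by
    rw [List.pairwise_cons] at hd
    have ih := blocks_prob h0 h1 ha B hd.2 (fun L hL => hp L (List.mem_cons_of_mem _ hL))
    have hA : {ω : Sym2 V → Bool | ∀ L' ∈ L :: B, ¬ Chain (fun u v => ω s(u, v) = true) L'} =
        {ω | Chain (fun u v => ω s(u, v) = true) L}ᶜ ∩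
        {ω | ∀ L ∈ B, ¬ Chain (fun u v => ω s(u, v) = true) L} := by
      ext ω
      simp
    have hdis : Disjoint L.toFinset.sym2 B.flatten.toFinset.sym2 := by
      rw [Finset.disjoint_left]
      intro e
      induction e using Sym2.ind with
      | h x y =>
        intro he he2
        simp at he he2
        obtain ⟨⟨M, hM, hxM⟩, _⟩ := he2
        exact hd.1 M hM he.1 hxM
    have hd1 : DetBy L.toFinset.sym2
        ({ω | Chain (fun u v => ω s(u, v) = true) L}ᶜ : Set (Sym2 V → Bool)) := by
      intro ω ω' he h h'
      exact h (chain_detBy L ω' ω (fun e hE => (he e hE).symm) h')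
    have hd2 : DetBy B.flatten.toFinset.sym2
        {ω : Sym2 V → Bool | ∀ L ∈ B, ¬ Chain (fun u v => ω s(u, v) = true) L} := by
      intro ω ω' he h M hM h'
      refine h M hM (chain_detBy M ω' ω (fun e hE => (he e ?_).symm) h')
      refine Finset.sym2_mono ?_ hE
      intro z hz
      simp at hz ⊢
      exact ⟨M, hM, hz⟩
    rw [hA, er_indep p hdis hd1 hd2, measureReal_compl (Set.toFinite _).measurableSet, probReal_univ,
      List.length_cons, pow_succ, mul_comm]
    have := hp L List.mem_cons_self
    exact mul_le_mul ih (by linarith) (by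
      have := measureReal_le_one (μ := erMeasure V p)
        (s := {ω | Chain (fun u v => ω s(u, v) = true) L})
      linarith) (pow_nonneg (by linarith) _)

end partB

end Jigsaw

namespace Jigsaw

section partC
variable {V : Type*} [Fintype V] [DecidableEq V]

lemma exists_parent {G : SimpleGraph V} (hc : G.Connected) (r : V) :
    ∃ (par : V → V) (d : V → ℕ), par r = r ∧ ∀ v, v ≠ r → G.Adj (par v) v ∧ d (par v) < d v := by
  have h : ∀ v, ∃ u, (v = r → u = r) ∧ (v ≠ r → G.Adj u v ∧ G.dist u r < G.dist v r) := by
    intro v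
    by_cases hv : v = r
    · exact ⟨r, fun _ => rfl, fun h => absurd hv h⟩
    · obtain ⟨w, hw⟩ := hc.exists_walk_length_eq_dist v r
      cases w with
      | nil => exact absurd rfl hv
      | @cons _ u _ h w' =>
        refine ⟨u, fun h => absurd h hv, fun _ => ⟨h.symm, ?_⟩⟩
        have := SimpleGraph.dist_le w'
        rw [SimpleGraph.Walk.length_cons] at hw
        omega
  choose par hpar using h
  exact ⟨par, fun v => G.dist v r, (hpar r).1 rfl, fun v hv => (hpar v).2 hv⟩

lemma exists_chain {G : SimpleGraph V} {par : V → V} {d : V → ℕ} (v : V) (T : Finset V)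
    (h0 : ∀ w ∈ T, w ≠ v → G.Adj (par w) w ∧ d (par w) < d w ∧ d v < d w) :
    (∀ w ∈ T, w ≠ v → par w ∈ T) →
    ∃ L : List V, L.Nodup ∧ L.toFinset = T ∧ Chain G.Adj L := by
  induction T using Finset.induction_on_max_value d with
  | empty => intro _; exact ⟨[], List.nodup_nil, rfl, trivial⟩
  | insert a s ha hmax ih =>
    intro hcl
    obtain ⟨L, hn, hL, hch⟩ := ih (fun w hw => h0 w (Finset.mem_insert_of_mem hw)) (by
      intro w hw hne
      have h1 := hcl w (Finset.mem_insert_of_mem hw) hne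
      rcases Finset.mem_insert.1 h1 with h | h
      · have := (h0 w (Finset.mem_insert_of_mem hw) hne).2.1
        have := hmax w hw
        rw [h] at *
        omega
      · exact h)
    have haL : a ∉ L := by rw [← List.mem_toFinset, hL]; exact ha
    refine ⟨a :: L, List.nodup_cons.2 ⟨haL, hn⟩, by simp [hL], ?_, hch⟩
    by_cases hLe : L = []
    · exact Or.inl hLe
    · right
      have hav : a ≠ v := by
        rintro rfl
        obtain ⟨x, hx⟩ := List.exists_mem_of_ne_nil L hLe
        have hxs : x ∈ s := by rw [← hL]; simpa using hx
        have h1 := hmax x hxs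
        have h2 := (h0 x (Finset.mem_insert_of_mem hxs) (fun h => ha (h ▸ hxs))).2.2
        omega
      have h1 := h0 a (Finset.mem_insert_self _ _) hav
      refine ⟨par a, ?_, h1.1⟩
      have h2 := hcl a (Finset.mem_insert_self _ _) hav
      rcases Finset.mem_insert.1 h2 with h | h
      · have := h1.2.1
        rw [h] at this; omega
      · rw [← hL] at h; simpa using h

open Classical in
/-- Descendants of `v` inside `S`. -/
noncomputable def desc (par : V → V) (S : Finset V) (v : V) : Finset V :=
  S.filter fun w => ∃ i, par^[i] w = v

lemma exists_block {G : SimpleGraph V} {D k : ℕ} (hD : 1 ≤ D) (hk : 1 ≤ k)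
    (hdeg : ∀ v, (G.neighborSet v).ncard ≤ D) {r : V} {par : V → V} {d : V → ℕ} (hr : par r = r)
    (hpar : ∀ v, v ≠ r → G.Adj (par v) v ∧ d (par v) < d v) (S : Finset V)
    (hS : ∀ w ∈ S, par w ∈ S) (hSk : k ≤ S.card) :
    ∃ L : List V, L.Nodup ∧ Chain G.Adj L ∧ k ≤ L.length ∧ L.length ≤ D * k ∧ L.toFinset ⊆ S ∧
      ∀ w ∈ S \ L.toFinset, par w ∈ S \ L.toFinset := by
  classical
  have hit : ∀ m : ℕ, ∀ w, d w = m → ∃ i, par^[i] w = r := by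
    intro m
    induction m using Nat.strong_induction_on with
    | _ m ih =>
      intro w hw
      by_cases h : w = r
      · exact ⟨0, h⟩
      · obtain ⟨i, hi⟩ := ih _ (hw ▸ (hpar w h).2) (par w) rfl
        exact ⟨i + 1, hi⟩
  have hSi : ∀ i : ℕ, ∀ w ∈ S, par^[i] w ∈ S := by
    intro i
    induction i with
    | zero => exact fun w hw => hw
    | succ i ih => exact fun w hw => ih _ (hS w hw)
  have hrS : r ∈ S := by
    obtain ⟨w, hw⟩ := Finset.card_pos.1 (lt_of_lt_of_le hk hSk)
    obtain ⟨i, hi⟩ := hit _ w rfl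
    exact hi ▸ hSi i w hw
  have hdr : desc par S r = S := by
    apply Finset.filter_true_of_mem
    intro w _
    exact hit _ w rfl
  obtain ⟨v, hv, hvmax⟩ := Finset.exists_max_image (S.filter fun v => k ≤ (desc par S v).card) d
    ⟨r, Finset.mem_filter.2 ⟨hrS, by rw [hdr]; exact hSk⟩⟩
  rw [Finset.mem_filter] at hv
  have hdle : ∀ i : ℕ, ∀ w, d (par^[i] w) ≤ d w := by
    intro i
    induction i with
    | zero => exact fun w => le_rfl
    | succ i ih =>
      intro w
      refine (ih (par w)).trans ?_
      by_cases h : w = r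
      · rw [h, hr]
      · exact (hpar w h).2.le
  have hmemT : ∀ w, w ∈ desc par S v ↔ w ∈ S ∧ ∃ i, par^[i] w = v := by
    intro w; simp [desc]
  have hnr : ∀ w ∈ desc par S v, w ≠ v → w ≠ r := by
    rintro w hw hne rfl
    obtain ⟨_, i, hi⟩ := (hmemT _).1 hw
    rw [Function.iterate_fixed hr] at hi
    exact hne hi
  have hparT : ∀ w ∈ desc par S v, w ≠ v → par w ∈ desc par S v := by
    intro w hw hne
    obtain ⟨hwS, i, hi⟩ := (hmemT w).1 hw
    rw [hmemT]
    refine ⟨hS w hwS, ?_⟩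
    cases i with
    | zero => exact absurd hi hne
    | succ i => exact ⟨i, hi⟩
  have hdlt : ∀ w ∈ desc par S v, w ≠ v → d v < d w := by
    intro w hw hne
    obtain ⟨_, i, hi⟩ := (hmemT _).1 (hparT w hw hne)
    have h1 := hdle i (par w)
    rw [hi] at h1
    exact lt_of_le_of_lt h1 (hpar w (hnr w hw hne)).2
  obtain ⟨L, hn, hL, hch⟩ := exists_chain (G := G) (par := par) (d := d) v (desc par S v)
    (fun w hw hne => ⟨(hpar w (hnr w hw hne)).1, (hpar w (hnr w hw hne)).2, hdlt w hw hne⟩) hparT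
  have hlen : L.length = (desc par S v).card := by
    rw [← hL, List.toFinset_card_of_nodup hn]
  refine ⟨L, hn, hch, hlen ▸ hv.2, ?_, ?_, ?_⟩
  · rw [hlen]
    set Ch := S.filter fun c => par c = v ∧ c ≠ r with hCh
    have hsub : desc par S v ⊆ insert v (Ch.biUnion fun c => desc par S c) := by
      intro w hw
      rw [Finset.mem_insert]
      by_cases hwv : w = v
      · exact Or.inl hwv
      right
      have hex := ((hmemT w).1 hw).2
      have hwS := ((hmemT w).1 hw).1
      have hf := Nat.find_spec hex
      have hmin := fun j => Nat.find_min hex (m := j)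
      rcases hfi : Nat.find hex with _ | i
      · rw [hfi] at hf; exact absurd hf hwv
      · rw [hfi] at hf hmin
        rw [Finset.mem_biUnion]
        refine ⟨par^[i] w, ?_, ?_⟩
        · rw [hCh, Finset.mem_filter]
          rw [Function.iterate_succ_apply'] at hf
          refine ⟨hSi i w hwS, hf, ?_⟩
          intro h
          apply hmin i (by omega)
          rw [h, hr] at hf
          rw [h, hf]
        · simp only [desc, Finset.mem_filter]
          exact ⟨hwS, i, rfl⟩
    have hChc : Ch.card ≤ D := by
      refine le_trans ?_ (hdeg v)
      rw [← Set.ncard_coe_finset]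
      apply Set.ncard_le_ncard _ (Set.toFinite _)
      intro c hc
      have hc' : c ∈ S ∧ par c = v ∧ c ≠ r := by simpa [hCh] using hc
      have := (hpar c hc'.2.2).1
      rw [hc'.2.1] at this
      exact this
    have hsm : ∀ c ∈ Ch, (desc par S c).card ≤ k - 1 := by
      intro c hc
      have hc' : c ∈ S ∧ par c = v ∧ c ≠ r := by simpa [hCh] using hc
      by_contra hcon
      have h1 := hvmax c (Finset.mem_filter.2 ⟨hc'.1, by omega⟩)
      have h2 := (hpar c hc'.2.2).2
      rw [hc'.2.1] at h2
      omega
    have h1 := Finset.card_le_card hsub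
    have h2 := Finset.card_insert_le v (Ch.biUnion fun c => desc par S c)
    have h3 := Finset.card_biUnion_le_card_mul Ch (fun c => desc par S c) (k - 1) hsm
    have h4 : Ch.card * (k - 1) ≤ D * (k - 1) := Nat.mul_le_mul_right _ hChc
    have h5 : D * (k - 1) + D = D * k := by
      rw [← Nat.mul_succ]; congr 1; omega
    omega
  · rw [hL]; exact Finset.filter_subset _ _
  · intro w hw
    rw [hL, Finset.mem_sdiff] at *
    refine ⟨hS w hw.1, fun h => hw.2 ?_⟩
    obtain ⟨_, i, hi⟩ := (hmemT _).1 h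
    exact (hmemT _).2 ⟨hw.1, i + 1, hi⟩

lemma exists_blocks {G : SimpleGraph V} {D k : ℕ} (hD : 1 ≤ D) (hk : 1 ≤ k)
    (hdeg : ∀ v, (G.neighborSet v).ncard ≤ D) {r : V} {par : V → V} {d : V → ℕ} (hr : par r = r)
    (hpar : ∀ v, v ≠ r → G.Adj (par v) v ∧ d (par v) < d v) : ∀ (m : ℕ) (S : Finset V), S.card = m →
    (∀ w ∈ S, par w ∈ S) →
    ∃ B : List (List V), (∀ L ∈ B, L.Nodup ∧ Chain G.Adj L ∧ k ≤ L.length ∧ L.length ≤ D * k ∧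
      L.toFinset ⊆ S) ∧ B.Pairwise List.Disjoint ∧ S.card < B.length * (D * k) + k := by
  intro m
  induction m using Nat.strong_induction_on with
  | _ m ih =>
    intro S hm hS
    by_cases hSk : k ≤ S.card
    · obtain ⟨L, hn, hch, h1, h2, h3, h4⟩ := exists_block hD hk hdeg hr hpar S hS hSk
      have hcard : (S \ L.toFinset).card + L.length = S.card := by
        rw [← List.toFinset_card_of_nodup hn, Finset.card_sdiff_add_card_eq_card h3]
      obtain ⟨B, hB, hBd, hBc⟩ := ih (S \ L.toFinset).card (by omega) _ rfl h4
      refine ⟨L :: B, ?_, ?_, ?_⟩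
      · intro M hM
        rcases List.mem_cons.1 hM with rfl | hM
        · exact ⟨hn, hch, h1, h2, h3⟩
        · obtain ⟨a, b, c, e, f⟩ := hB M hM
          exact ⟨a, b, c, e, f.trans Finset.sdiff_subset⟩
      · rw [List.pairwise_cons]
        refine ⟨fun M hM x hx hxM => ?_, hBd⟩
        have := (hB M hM).2.2.2.2 (List.mem_toFinset.2 hxM)
        rw [Finset.mem_sdiff, List.mem_toFinset] at this
        exact this.2 hx
      · rw [List.length_cons, Nat.succ_mul]
        omega
    · exact ⟨[], by simp, List.Pairwise.nil, by simp; omega⟩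

end partC

end Jigsaw

namespace Jigsaw

section partD

lemma one_add_sq_le_exp {x : ℝ} (hx : 0 ≤ x) : 1 + x ^ 2 ≤ Real.exp x := by
  have h := Real.sum_le_exp_of_nonneg hx 4
  norm_num [Finset.sum_range_succ, Nat.factorial] at h
  nlinarith [mul_nonneg hx (sq_nonneg (x - 3/2)), mul_nonneg hx hx]

lemma exp_neg_inv_sq_le {x : ℝ} (hx : 0 < x) : Real.exp (-(1 / x ^ 2)) ≤ 1 - Real.exp (-x) := by
  have h1 : Real.exp (-x) ≤ 1 / (1 + x ^ 2) := by
    rw [Real.exp_neg, ← one_div]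
    exact one_div_le_one_div_of_le (by positivity) (one_add_sq_le_exp hx.le)
  have h2 : Real.exp (-(1 / x ^ 2)) ≤ 1 / (1 + 1 / x ^ 2) := by
    rw [Real.exp_neg, ← one_div]
    refine one_div_le_one_div_of_le (by positivity) ?_
    have := Real.add_one_le_exp (1 / x ^ 2)
    linarith
  have h3 : 1 / (1 + 1 / x ^ 2) = 1 - 1 / (1 + x ^ 2) := by field_simp; ring
  linarith

lemma div_le_one_sub_exp {x : ℝ} (hx : 0 ≤ x) : x / (1 + x) ≤ 1 - Real.exp (-x) := by
  have h1 : Real.exp (-x) ≤ 1 / (1 + x) := by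
    rw [Real.exp_neg, ← one_div]
    refine one_div_le_one_div_of_le (by positivity) ?_
    have := Real.add_one_le_exp x
    linarith
  have h3 : x / (1 + x) = 1 - 1 / (1 + x) := by field_simp; ring
  linarith

lemma factor_lower {p : ℝ} {M : ℕ} (hM : 1 ≤ M) (hp : 1 / (M : ℝ) ≤ p) (h1 : p ≤ 1) (j : ℕ) :
    1 - Real.exp (-((j : ℝ) / M)) ≤ 1 - (1 - p) ^ j := by
  have h : (1 - p) ^ j ≤ Real.exp (-(1 / (M : ℝ))) ^ j := by
    apply pow_le_pow_left₀ (by linarith)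
    have := Real.add_one_le_exp (-(1 / (M : ℝ)))
    linarith
  rw [← Real.exp_nat_mul] at h
  have e : (j : ℝ) * -(1 / (M : ℝ)) = -((j : ℝ) / M) := by ring
  rw [e] at h
  linarith

lemma prod_phase1 (M : ℕ) (K : ℕ) :
    ∏ i ∈ Finset.range K, (((i + 1 : ℕ) : ℝ) / ((M : ℝ) + (i + 1 : ℕ))) = 1 / ((M + K).choose K : ℝ) := by
  induction K with
  | zero => simp
  | succ K ih =>
    rw [Finset.prod_range_succ, ih]
    have h := Nat.add_one_mul_choose_eq (M + K) K
    have h' : ((M : ℝ) + K + 1) * ((M + K).choose K : ℝ) = ((M + K + 1).choose (K + 1) : ℝ) * (K + 1) := by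
      exact_mod_cast h
    have c1 : 0 < ((M + K).choose K : ℝ) := by exact_mod_cast Nat.choose_pos (by omega)
    have c2 : 0 < ((M + (K + 1)).choose (K + 1) : ℝ) := by exact_mod_cast Nat.choose_pos (by omega)
    rw [← add_assoc] at c2 ⊢
    push_cast
    have : (0:ℝ) < M + (K + 1) := by positivity
    field_simp
    linarith

lemma prod_lower {p : ℝ} {M : ℕ} (hM : 1 ≤ M) (hp : 1 / (M : ℝ) ≤ p) (h1 : p ≤ 1) (K : ℕ) :
    (1 / 4 : ℝ) ^ M * Real.exp (-(M : ℝ)) ≤ ∏ j ∈ Finset.range K, (1 - (1 - p) ^ (j + 1)) := by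
  have hM0 : (0 : ℝ) < M := by exact_mod_cast hM
  have hp0 : 0 < p := lt_of_lt_of_le (by positivity) hp
  have f0 : ∀ j : ℕ, 0 ≤ 1 - (1 - p) ^ j := fun j => by
    have := pow_le_one₀ (n := j) (by linarith : 0 ≤ 1 - p) (by linarith)
    linarith
  have f1 : ∀ j : ℕ, 1 - (1 - p) ^ j ≤ 1 := fun j => by
    have := pow_nonneg (by linarith : 0 ≤ 1 - p) j
    linarith
  have hanti : Antitone (fun K => ∏ j ∈ Finset.range K, (1 - (1 - p) ^ (j + 1))) := by
    apply antitone_nat_of_succ_le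
    intro K
    rw [Finset.prod_range_succ]
    exact mul_le_of_le_one_right (Finset.prod_nonneg fun j _ => f0 _) (f1 _)
  have key : ∀ t : ℕ, (1 / 4 : ℝ) ^ M * Real.exp (-((M : ℝ) - (M : ℝ) ^ 2 / (M + t))) ≤
      ∏ j ∈ Finset.range (M + t), (1 - (1 - p) ^ (j + 1)) := by
    intro t
    induction t with
    | zero =>
      have e : (M : ℝ) - (M : ℝ) ^ 2 / (M + (0 : ℕ)) = 0 := by
        push_cast; field_simp; ring
      rw [e]
      simp only [neg_zero, Real.exp_zero, mul_one, add_zero]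
      calc (1 / 4 : ℝ) ^ M ≤ 1 / ((M + M).choose M : ℝ) := by
            rw [one_div_pow]
            apply one_div_le_one_div_of_le
            · exact_mod_cast Nat.choose_pos (by omega)
            · have := Nat.choose_le_two_pow (M + M) M
              have h2 : (2 : ℕ) ^ (M + M) = 4 ^ M := by
                rw [← two_mul, pow_mul]; norm_num
              rw [h2] at this
              exact_mod_cast this
        _ = _ := (prod_phase1 M M).symm
        _ ≤ _ := by
            apply Finset.prod_le_prod
            · intro i _; positivity
            · intro i _
              refine le_trans ?_ (factor_lower hM hp h1 (i + 1))
              refine le_trans (le_of_eq ?_) (div_le_one_sub_exp (by positivity))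
              field_simp
    | succ t ih =>
      rw [← add_assoc, Finset.prod_range_succ]
      have hj : (0 : ℝ) < (M : ℝ) + t := by positivity
      have hs : (M : ℝ) ^ 2 / ((M : ℝ) + t + 1) ^ 2 ≤
          (M : ℝ) ^ 2 / (M + t) - (M : ℝ) ^ 2 / (M + t + 1) := by
        have : (M : ℝ) ^ 2 / (M + t) - (M : ℝ) ^ 2 / (M + t + 1) =
          (M : ℝ) ^ 2 / ((M + t) * (M + t + 1)) := by field_simp; ring
        rw [this]
        apply div_le_div_of_nonneg_left (by positivity) (by positivity)
        nlinarith
      have hf : Real.exp (-((M : ℝ) ^ 2 / ((M : ℝ) + t + 1) ^ 2)) ≤ 1 - (1 - p) ^ (M + t + 1) := by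
        refine le_trans ?_ (factor_lower hM hp h1 (M + t + 1))
        refine le_trans (le_of_eq ?_) (exp_neg_inv_sq_le (by positivity))
        push_cast
        congr 2
        field_simp
      calc (1 / 4 : ℝ) ^ M * Real.exp (-((M : ℝ) - (M : ℝ) ^ 2 / (M + ((t + 1 : ℕ) : ℝ))))
          ≤ (1 / 4 : ℝ) ^ M * (Real.exp (-((M : ℝ) - (M : ℝ) ^ 2 / (M + t))) *
              Real.exp (-((M : ℝ) ^ 2 / ((M : ℝ) + t + 1) ^ 2))) := by
            rw [← Real.exp_add]
            gcongr
            push_cast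
            rw [← add_assoc]
            linarith
        _ ≤ _ := by
            rw [← mul_assoc]
            exact mul_le_mul ih hf (Real.exp_pos _).le (Finset.prod_nonneg fun j _ => f0 _)
  calc _ ≤ (1 / 4 : ℝ) ^ M * Real.exp (-((M : ℝ) - (M : ℝ) ^ 2 / (M + K))) := by
        gcongr
        have : 0 ≤ (M : ℝ) ^ 2 / (M + K) := by positivity
        linarith
    _ ≤ _ := key K
    _ ≤ _ := hanti (by omega)

end partD

end Jigsaw

namespace Jigsaw

section partE
variable {V : Type*}

/-- `S` is connected in both graphs. -/
def Dbl (Gpe Gpu : SimpleGraph V) (S : Set V) : Prop :=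
  (Gpe.induce S).Connected ∧ (Gpu.induce S).Connected

lemma Dbl.union {Gpe Gpu : SimpleGraph V} {S T : Set V} (hS : Dbl Gpe Gpu S) (hT : Dbl Gpe Gpu T)
    (h1 : SetAdj Gpe S T) (h2 : SetAdj Gpu S T) : Dbl Gpe Gpu (S ∪ T) := by
  obtain ⟨u, hu, w, hw, ha⟩ := h1
  obtain ⟨u', hu', w', hw', ha'⟩ := h2
  exact ⟨SimpleGraph.connected_induce_union hS.1.preconnected hT.1.preconnected hu hw ha,
    SimpleGraph.connected_induce_union hS.2.preconnected hT.2.preconnected hu' hw' ha'⟩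

lemma clusters_small [Finite V] {Gpe Gpu : SimpleGraph V} {l : ℕ} (hl : 1 < l)
    (hno : ∀ S, Dbl Gpe Gpu S → S.ncard < 2 * l → S.ncard < l) (i : ℕ) :
    ∀ U ∈ clusters Gpe Gpu i, Dbl Gpe Gpu U ∧ U.ncard < l := by
  induction i with
  | zero =>
    rintro U ⟨v, rfl⟩
    refine ⟨⟨?_, ?_⟩, by simpa using hl⟩ <;>
    · exact { preconnected := fun a b => by rw [Subsingleton.elim a b], nonempty := ⟨⟨v, rfl⟩⟩ }
  | succ i ih =>
    rintro U ⟨c, rfl⟩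
    induction c using SimpleGraph.ConnectedComponent.ind with
    | h A =>
    set CG := clusterGraph Gpe Gpu (clusters Gpe Gpu i) with hCG
    set R : Set (Set V) := {U : Set V | ∃ h : U ∈ clusters Gpe Gpu i,
        CG.connectedComponentMk ⟨U, h⟩ = CG.connectedComponentMk A} with hR
    have hfin : {F : Set (Set V) | A.1 ∈ F ∧ F ⊆ R ∧ Dbl Gpe Gpu (⋃₀ F) ∧ (⋃₀ F).ncard < l}.Finite :=
      Set.toFinite _
    obtain ⟨F, hF⟩ := hfin.exists_maximal ⟨{A.1}, rfl, by
      rintro _ rfl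
      exact ⟨A.2, rfl⟩, by simpa using (ih A.1 A.2).1, by simpa using (ih A.1 A.2).2⟩
    obtain ⟨hAF, hFR, hFD, hFl⟩ := hF.prop
    suffices hRF : R = F by rw [hRF]; exact ⟨hFD, hFl⟩
    refine subset_antisymm ?_ hFR
    by_contra hcon
    obtain ⟨W, hWR, hWF⟩ := Set.not_subset.1 hcon
    obtain ⟨hW, hWc⟩ := hWR
    obtain ⟨w⟩ := (SimpleGraph.ConnectedComponent.eq.1 hWc).symm
    obtain ⟨d, hd, hd1, hd2⟩ := w.exists_boundary_dart {x | x.1 ∈ F} hAF hWF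
    obtain ⟨hne, ha, hb⟩ : d.fst ≠ d.snd ∧ SetAdj Gpe d.fst.1 d.snd.1 ∧ SetAdj Gpu d.fst.1 d.snd.1 :=
      d.adj
    have hmono : ∀ {G : SimpleGraph V}, SetAdj G d.fst.1 d.snd.1 → SetAdj G (⋃₀ F) d.snd.1 := by
      rintro G ⟨u, hu, w, hw, h⟩
      exact ⟨u, ⟨d.fst.1, hd1, hu⟩, w, hw, h⟩
    have hU := hFD.union (ih d.snd.1 d.snd.2).1 (hmono ha) (hmono hb)
    have hUe : ⋃₀ (insert d.snd.1 F) = ⋃₀ F ∪ d.snd.1 := by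
      rw [Set.sUnion_insert, Set.union_comm]
    have hcard : (⋃₀ F ∪ d.snd.1).ncard < l := by
      apply hno _ hU
      have h1 := Set.ncard_union_le (⋃₀ F) d.snd.1
      have h2 := (ih d.snd.1 d.snd.2).2
      omega
    have := hF.le_of_ge (y := insert d.snd.1 F) ⟨Set.mem_insert_of_mem _ hAF, by
      rw [Set.insert_subset_iff]
      refine ⟨?_, hFR⟩
      obtain ⟨h, hh⟩ := hFR hd1
      refine ⟨d.snd.2, ?_⟩
      rw [← hh, SimpleGraph.ConnectedComponent.eq]
      exact d.adj.reachable.symm, by rw [hUe]; exact hU, by rw [hUe]; exact hcard⟩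
      (Set.subset_insert _ _)
    exact hd2 (this (Set.mem_insert _ _))

lemma exists_dbl [Finite V] {Gpe Gpu : SimpleGraph V} {l : ℕ} (hl : 1 < l) (hV : l ≤ Nat.card V)
    (hs : Solves Gpe Gpu) : ∃ S, Dbl Gpe Gpu S ∧ S.ncard < 2 * l ∧ l ≤ S.ncard := by
  by_contra! hcon
  obtain ⟨i, hi⟩ := hs
  have := (clusters_small hl hcon i Set.univ (by rw [hi]; rfl)).2
  rw [Set.ncard_univ] at this
  omega

variable [Fintype V] [DecidableEq V]

open Classical in
/-- The set of vertices reachable by a walk of length at most `r`. -/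
noncomputable def wball (G : SimpleGraph V) (v : V) (r : ℕ) : Finset V :=
  Finset.univ.filter fun u => ∃ w : G.Walk v u, w.length ≤ r

lemma wball_card {G : SimpleGraph V} {D : ℕ} (hdeg : ∀ v, (G.neighborSet v).ncard ≤ D) (r : ℕ) :
    ∀ v, (wball G v r).card ≤ (D + 1) ^ r := by
  classical
  induction r with
  | zero =>
    intro v
    rw [pow_zero, Finset.card_le_one]
    have : ∀ a ∈ wball G v 0, a = v := by
      intro a ha
      obtain ⟨w, hw⟩ := (Finset.mem_filter.1 ha).2
      exact (SimpleGraph.Walk.eq_of_length_eq_zero (Nat.le_zero.1 hw)).symm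
    intro a ha b hb
    rw [this a ha, this b hb]
  | succ r ih =>
    intro v
    have hsub : wball G v (r + 1) ⊆ insert v ((G.neighborFinset v).biUnion fun u => wball G u r) := by
      intro a ha
      obtain ⟨w, hw⟩ := (Finset.mem_filter.1 ha).2
      cases w with
      | nil => exact Finset.mem_insert_self _ _
      | @cons _ u _ h w' =>
        apply Finset.mem_insert_of_mem
        rw [Finset.mem_biUnion]
        refine ⟨u, by simpa using h, ?_⟩
        rw [SimpleGraph.Walk.length_cons] at hw
        exact Finset.mem_filter.2 ⟨Finset.mem_univ _, w', by omega⟩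
    have h1 := Finset.card_le_card hsub
    have h2 := Finset.card_insert_le v ((G.neighborFinset v).biUnion fun u => wball G u r)
    have h3 := Finset.card_biUnion_le_card_mul (G.neighborFinset v) (fun u => wball G u r)
      ((D + 1) ^ r) (fun u _ => ih u)
    have h4 : (G.neighborFinset v).card ≤ D := by
      rw [← Set.ncard_coe_finset]
      simpa using hdeg v
    have h5 : (G.neighborFinset v).card * (D + 1) ^ r ≤ D * (D + 1) ^ r := Nat.mul_le_mul_right _ h4
    have h6 : 1 ≤ (D + 1) ^ r := Nat.one_le_pow _ _ (by omega)
    rw [pow_succ]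
    nlinarith

lemma subset_wball {G : SimpleGraph V} {S : Set V} (hS : (G.induce S).Connected) {r : ℕ}
    (hr : S.ncard < r) {v : V} (hv : v ∈ S) : S ⊆ wball G v r := by
  classical
  intro u hu
  obtain ⟨p, hp⟩ := hS.exists_isPath ⟨v, hv⟩ ⟨u, hu⟩
  have h1 := hp.length_lt
  rw [← Nat.card_eq_fintype_card, Nat.card_coe_set_eq] at h1
  rw [Finset.mem_coe]
  have h2 := SimpleGraph.Walk.length_map (SimpleGraph.Embedding.induce (G := G) S).toHom p
  exact Finset.mem_filter.2 ⟨Finset.mem_univ _, p.map (SimpleGraph.Embedding.induce S).toHom,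
    h2.le.trans (by omega)⟩

lemma solves_imp {ω : Sym2 V → Bool} {G : SimpleGraph V} {l : ℕ} (hl : 1 < l)
    (hV : l ≤ Fintype.card V) (hs : Solves (graphOf ω) G) :
    ∃ v : V, ∃ F ∈ (wball G v (2 * l)).sym2.powersetCard (l - 1), ∀ e ∈ F, ω e = true := by
  classical
  obtain ⟨S, ⟨h1, h2⟩, h3, h4⟩ := exists_dbl hl (by rwa [Nat.card_eq_fintype_card]) hs
  obtain ⟨v, hv⟩ : S.Nonempty := by
    rw [← Set.ncard_pos]; omega
  have hsub := subset_wball h2 h3 hv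
  have hc := h1.card_vert_le_card_edgeSet_add_one
  rw [Nat.card_coe_set_eq] at hc
  set E : Finset (Sym2 V) := ((graphOf ω).induce S).edgeFinset.image (Sym2.map Subtype.val) with hE
  have hEc : l - 1 ≤ E.card := by
    rw [hE, Finset.card_image_of_injective _ (Sym2.map.injective Subtype.val_injective)]
    rw [Nat.card_eq_fintype_card, SimpleGraph.card_edgeSet] at hc
    omega
  obtain ⟨F, hFE, hFc⟩ := Finset.exists_subset_card_eq hEc
  have hEe : ∀ e ∈ E, e ∈ (wball G v (2 * l)).sym2 ∧ ω e = true := by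
    intro e he
    obtain ⟨e', he', rfl⟩ := Finset.mem_image.1 he
    induction e' using Sym2.ind with
    | h x y =>
      rw [SimpleGraph.mem_edgeFinset, SimpleGraph.mem_edgeSet] at he'
      have ha : (graphOf ω).Adj x.1 y.1 := he'
      refine ⟨?_, ha.2⟩
      rw [Sym2.map_mk, Finset.mk_mem_sym2_iff]
      exact ⟨hsub x.2, hsub y.2⟩
  exact ⟨v, F, Finset.mem_powersetCard.2 ⟨fun e he => (hEe e (hFE he)).1, hFc⟩,
    fun e he => (hEe e (hFE he)).2⟩

lemma solve_prob_le {G : SimpleGraph V} {D : ℕ} (hdeg : ∀ v, (G.neighborSet v).ncard ≤ D) {l : ℕ}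
    (hl : 1 < l) (hV : l ≤ Fintype.card V) {p : ℝ} (h0 : 0 ≤ p) (h1 : p ≤ 1) :
    (erMeasure V p).real {ω | Solves (graphOf ω) G} ≤
      (Fintype.card V : ℝ) * ((2 : ℝ) ^ (((D + 1) ^ (2 * l) + 1).choose 2) * p ^ (l - 1)) := by
  have hsub : {ω | Solves (graphOf ω) G} ⊆ ⋃ v ∈ (Finset.univ : Finset V),
      ⋃ F ∈ (wball G v (2 * l)).sym2.powersetCard (l - 1), {ω | ∀ e ∈ F, ω e = true} := by
    intro ω hω
    obtain ⟨v, F, hF, h⟩ := solves_imp hl hV hω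
    simp only [Set.mem_iUnion]
    exact ⟨v, Finset.mem_univ _, F, hF, h⟩
  refine (measureReal_mono hsub (measure_ne_top _ _)).trans ?_
  refine (measureReal_biUnion_finset_le _ _).trans ?_
  rw [← nsmul_eq_mul, ← Finset.card_univ]
  apply Finset.sum_le_card_nsmul
  intro v _
  refine (measureReal_biUnion_finset_le _ _).trans ?_
  have : ∀ F ∈ (wball G v (2 * l)).sym2.powersetCard (l - 1),
      (erMeasure V p).real {ω | ∀ e ∈ F, ω e = true} = p ^ (l - 1) := by
    intro F hF
    rw [er_open h0 h1, (Finset.mem_powersetCard.1 hF).2]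
  rw [Finset.sum_congr rfl this, Finset.sum_const, nsmul_eq_mul]
  gcongr
  have h2 : ((wball G v (2 * l)).sym2.powersetCard (l - 1)).card ≤
      2 ^ (((D + 1) ^ (2 * l) + 1).choose 2) := by
    rw [Finset.card_powersetCard, Finset.card_sym2]
    refine (Nat.choose_le_two_pow _ _).trans (Nat.pow_le_pow_right (by norm_num) ?_)
    exact Nat.choose_le_choose 2 (by have := wball_card hdeg (2 * l) v; omega)
  exact_mod_cast h2

end partE

end Jigsaw

namespace Jigsaw

section partF
variable {V : Type*} [Fintype V] [DecidableEq V]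

lemma not_solve_prob_le {G : SimpleGraph V} (hc : G.Connected) {D k M m : ℕ} (hD : 1 ≤ D) (hk : 1 ≤ k)
    (hM : 1 ≤ M) (hdeg : ∀ v, (G.neighborSet v).ncard ≤ D) {p : ℝ} (hp : 1 / (M : ℝ) ≤ p) (h1 : p ≤ 1)
    (hm : m * (D * k) + k ≤ Fintype.card V) :
    (erMeasure V p).real {ω | ¬ Solves (graphOf ω) G} ≤
      (1 - (1 / 4 : ℝ) ^ M * Real.exp (-(M : ℝ))) ^ m +
        (Fintype.card V : ℝ) * ((Fintype.card V : ℝ) * (1 - p) ^ k) := by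
  classical
  have hM0 : (0 : ℝ) < M := by exact_mod_cast hM
  have h0 : 0 ≤ p := le_trans (by positivity) hp
  obtain ⟨r⟩ := hc.nonempty
  obtain ⟨par, d, hr, hpar⟩ := exists_parent hc r
  obtain ⟨B₀, hB₀, hB₀d, hB₀c⟩ := exists_blocks hD hk hdeg hr hpar _ Finset.univ rfl (by simp)
  rw [Finset.card_univ] at hB₀c
  have hml : m ≤ B₀.length := by
    by_contra hcon
    have : B₀.length * (D * k) ≤ m * (D * k) := Nat.mul_le_mul_right _ (by omega)
    omega
  set B := B₀.take m with hBdef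
  have hBl : B.length = m := by simp [hBdef, hml]
  have hB : ∀ L ∈ B, L.Nodup ∧ Chain G.Adj L ∧ k ≤ L.length := fun L hL =>
    ⟨(hB₀ L (List.mem_of_mem_take hL)).1, (hB₀ L (List.mem_of_mem_take hL)).2.1,
      (hB₀ L (List.mem_of_mem_take hL)).2.2.1⟩
  have hBd : B.Pairwise List.Disjoint := hB₀d.sublist (List.take_sublist _ _)
  have hmV : B.toFinset.card ≤ Fintype.card V := by
    have h2 := List.toFinset_card_le B
    have h3 : m * 1 ≤ m * (D * k) := Nat.mul_le_mul_left _ (Nat.mul_pos hD hk)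
    omega
  set X : Set (Sym2 V → Bool) := {ω | ∀ L ∈ B, ¬ Chain (fun u v => ω s(u, v) = true) L} with hX
  set Y : Set (Sym2 V → Bool) := ⋃ L ∈ B.toFinset, ⋃ v ∈ (Finset.univ.filter fun v => v ∉ L),
    {ω | ∀ e ∈ L.toFinset.image (fun x => s(x, v)), ω e = false} with hY
  have hsub : {ω | ¬ Solves (graphOf ω) G} ⊆ X ∪ Y := by
    intro ω hω
    by_contra hcon
    rw [Set.mem_union, not_or] at hcon
    obtain ⟨hnX, hnY⟩ := hcon
    apply hω
    simp only [hX, Set.mem_setOf_eq, not_forall, not_not] at hnX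
    obtain ⟨L, hL, hch⟩ := hnX
    obtain ⟨hn, hG, hkL⟩ := hB L hL
    have hne : L ≠ [] := by
      rintro rfl
      simp at hkL
      omega
    obtain ⟨x, hx⟩ := List.exists_mem_of_ne_nil L hne
    refine (hch.inOne hn hne hG).solves_of_grow ⟨x, hx⟩ hc ?_
    intro v hv
    by_contra hno
    apply hnY
    simp only [hY, Set.mem_iUnion]
    refine ⟨L, List.mem_toFinset.2 hL, v, by simpa using hv, ?_⟩
    intro e he
    obtain ⟨u, hu, rfl⟩ := Finset.mem_image.1 he
    rw [List.mem_toFinset] at hu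
    by_contra hf
    exact hno ⟨u, hu, fun h => hv (h ▸ hu), by simpa using hf⟩
  have ha : (1 / 4 : ℝ) ^ M * Real.exp (-(M : ℝ)) ≤ 1 := by
    have := prod_lower hM hp h1 0
    simpa using this
  refine (measureReal_mono hsub (measure_ne_top _ _)).trans ?_
  refine (measureReal_union_le _ _).trans (add_le_add ?_ ?_)
  · rw [← hBl]
    apply blocks_prob h0 h1 ha B hBd
    intro L hL
    rw [chain_prob h0 h1 L (hB L hL).1]
    exact prod_lower hM hp h1 _
  · have hq : 0 ≤ 1 - p := by linarith
    refine (measureReal_biUnion_finset_le _ _).trans ?_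
    refine (Finset.sum_le_card_nsmul _ _ ((Fintype.card V : ℝ) * (1 - p) ^ k) ?_).trans ?_
    · intro L hL
      rw [List.mem_toFinset] at hL
      refine (measureReal_biUnion_finset_le _ _).trans ?_
      refine (Finset.sum_le_card_nsmul _ _ ((1 - p) ^ k) ?_).trans ?_
      · intro v hv
        rw [er_closed h0 h1, Finset.card_image_of_injective _ (fun a b h => Sym2.congr_left.1 h),
          List.toFinset_card_of_nodup (hB L hL).1]
        exact pow_le_pow_of_le_one hq (by linarith) (hB L hL).2.2
      · rw [nsmul_eq_mul]
        gcongr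
        exact Finset.card_le_univ _
    · rw [nsmul_eq_mul]
      gcongr

end partF

lemma ev_poly (D : ℕ) : ∀ᶠ x : ℝ in atTop, ((D : ℝ) + 1) * (x ^ 2 + 1) ≤ Real.exp (x / 2) := by
  have h := (isLittleO_pow_exp_pos_mul_atTop (k := 2) (b := 1 / 2) (by norm_num)).bound
    (c := 1 / (2 * ((D : ℝ) + 1))) (by positivity)
  filter_upwards [h, eventually_ge_atTop 1] with x hx h1
  rw [Real.norm_of_nonneg (by positivity), Real.norm_of_nonneg (Real.exp_pos _).le] at hx
  have e : (1 / 2 : ℝ) * x = x / 2 := by ring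
  rw [e, div_mul_eq_mul_div, one_mul, le_div_iff₀ (by positivity)] at hx
  have h2 : (1 : ℝ) ≤ x ^ 2 := one_le_pow₀ h1
  have h3 : ((D : ℝ) + 1) * (x ^ 2 + 1) ≤ ((D : ℝ) + 1) * (x ^ 2 + x ^ 2) := by gcongr
  linarith

lemma upper_bound {D : ℕ} (hD : 1 ≤ D) {n : ℕ} {G : SimpleGraph (Fin n)} (hc : G.Connected)
    (hdeg : ∀ v, (G.neighborSet v).ncard ≤ D) {p : ℝ} (h1 : p ≤ 1)
    (hx25 : 25 ≤ Real.log n) (hpoly : ((D : ℝ) + 1) * ((Real.log n) ^ 2 + 1) ≤ Real.exp (Real.log n / 2))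
    (hp : 10 / Real.log n < p) :
    (erMeasure (Fin n) p).real {ω | ¬ Solves (graphOf ω) G} < 1 / 2 := by
  set x := Real.log n with hx
  have hx0 : 0 < x := by linarith
  have hp0 : 0 < p := lt_trans (by positivity) hp
  have hn0 : (0 : ℝ) < n := by
    rcases Nat.eq_zero_or_pos n with h | h
    · exfalso; rw [h] at hx; simp at hx; linarith
    · exact_mod_cast h
  have hnx : Real.exp x = n := Real.exp_log hn0
  set M := ⌈x / 10⌉₊ with hM
  set k := ⌈x ^ 2⌉₊ with hk
  set m := Nat.sqrt n with hm
  have hM1 : 1 ≤ M := Nat.one_le_iff_ne_zero.2 (Nat.ceil_pos.2 (by positivity)).ne'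
  have hk1 : 1 ≤ k := Nat.one_le_iff_ne_zero.2 (Nat.ceil_pos.2 (by positivity)).ne'
  have hMl : x / 10 ≤ M := Nat.le_ceil _
  have hMu : (M : ℝ) < x / 10 + 1 := Nat.ceil_lt_add_one (by positivity)
  have hkl : x ^ 2 ≤ k := Nat.le_ceil _
  have hku : (k : ℝ) < x ^ 2 + 1 := Nat.ceil_lt_add_one (by positivity)
  have hy2 : Real.exp (x / 2) * Real.exp (x / 2) = n := by
    rw [← Real.exp_add, ← hnx]; congr 1; ring
  have hy0 := Real.exp_pos (x / 2)
  have hmu : (m : ℝ) ≤ Real.exp (x / 2) := by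
    have : (m : ℝ) * m ≤ n := by exact_mod_cast Nat.sqrt_le n
    nlinarith
  have hml : Real.exp (x / 2) ≤ m + 1 := by
    have : (n : ℝ) < (m + 1) * (m + 1) := by exact_mod_cast Nat.lt_succ_sqrt n
    have hm0 : (0 : ℝ) ≤ m := by positivity
    nlinarith
  have hcount : m * (D * k) + k ≤ Fintype.card (Fin n) := by
    rw [Fintype.card_fin]
    have h : (m : ℝ) * (D * k) + k ≤ n := by
      have hk' : (k : ℝ) ≤ x ^ 2 + 1 := hku.le
      have hy1 : 1 ≤ Real.exp (x / 2) := Real.one_le_exp (by positivity)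
      calc (m : ℝ) * (D * k) + k ≤ Real.exp (x / 2) * (D * (x ^ 2 + 1)) + Real.exp (x / 2) * (x ^ 2 + 1) := by
            gcongr
            nlinarith [sq_nonneg x]
        _ = Real.exp (x / 2) * (((D : ℝ) + 1) * (x ^ 2 + 1)) := by ring
        _ ≤ Real.exp (x / 2) * Real.exp (x / 2) := by gcongr
        _ = n := hy2
    exact_mod_cast h
  have hMp : 1 / (M : ℝ) ≤ p := by
    refine le_trans ?_ hp.le
    have : 10 / x = 1 / (x / 10) := by field_simp
    rw [this]
    exact one_div_le_one_div_of_le (by positivity) hMl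
  have main := not_solve_prob_le hc hD hk1 hM1 hdeg hMp h1 hcount
  rw [Fintype.card_fin] at main
  refine lt_of_le_of_lt main ?_
  have e4 : (4 : ℝ) < Real.exp 2 := by
    have := Real.exp_one_gt_d9
    have e : Real.exp 2 = Real.exp 1 * Real.exp 1 := by rw [← Real.exp_add]; norm_num
    rw [e]; nlinarith
  set a := (1 / 4 : ℝ) ^ M * Real.exp (-(M : ℝ)) with ha
  have ha1 : a ≤ 1 := by
    have := prod_lower hM1 hMp h1 0
    rwa [Finset.prod_range_zero] at this
  have hal : Real.exp (-(3 * x / 10 + 3)) ≤ a := by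
    have h2 : Real.exp (-2) ^ M ≤ (1 / 4 : ℝ) ^ M := by
      apply pow_le_pow_left₀ (Real.exp_pos _).le
      rw [Real.exp_neg, ← one_div]
      exact one_div_le_one_div_of_le (by norm_num) e4.le
    rw [← Real.exp_nat_mul] at h2
    calc Real.exp (-(3 * x / 10 + 3)) ≤ Real.exp ((M : ℝ) * -2) * Real.exp (-(M : ℝ)) := by
          rw [← Real.exp_add]
          apply Real.exp_le_exp.2
          linarith
      _ ≤ a := by rw [ha]; gcongr
  have ham : 2 ≤ a * m := by
    have hm' : Real.exp (x / 2) - 1 ≤ m := by linarith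
    have h3 : Real.exp (-(3 * x / 10 + 3)) * (Real.exp (x / 2) - 1) ≤ a * m := by
      apply mul_le_mul hal hm' _ (le_trans (Real.exp_pos _).le hal)
      have := Real.one_le_exp (by positivity : 0 ≤ x / 2)
      linarith
    have h4 : Real.exp (-(3 * x / 10 + 3)) * (Real.exp (x / 2) - 1) =
        Real.exp (x / 5 - 3) - Real.exp (-(3 * x / 10 + 3)) := by
      rw [mul_sub, ← Real.exp_add, mul_one]; congr 2; ring
    have h5 : Real.exp (-(3 * x / 10 + 3)) ≤ 1 := Real.exp_le_one_iff.2 (by linarith)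
    have h6 := Real.add_one_le_exp (x / 5 - 3)
    linarith
  have t1 : (1 - a) ^ m < 1 / 4 := by
    calc (1 - a) ^ m ≤ Real.exp (-a) ^ m := by
          apply pow_le_pow_left₀ (by linarith)
          have := Real.add_one_le_exp (-a)
          linarith
      _ = Real.exp (-(a * m)) := by rw [← Real.exp_nat_mul]; congr 1; ring
      _ ≤ Real.exp (-2) := Real.exp_le_exp.2 (by linarith)
      _ < 1 / 4 := by
          rw [Real.exp_neg, ← one_div]
          exact one_div_lt_one_div_of_lt (by norm_num) e4
  have t2 : (n : ℝ) * (n * (1 - p) ^ k) < 1 / 4 := by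
    have hpk : 10 * x ≤ p * k := by
      have : 10 ≤ p * x := by rw [div_lt_iff₀ hx0] at hp; exact hp.le
      calc 10 * x ≤ (p * x) * x := by gcongr
        _ = p * x ^ 2 := by ring
        _ ≤ p * k := by gcongr
    have h7 : (1 - p) ^ k ≤ Real.exp (-(10 * x)) := by
      calc (1 - p) ^ k ≤ Real.exp (-p) ^ k := by
            apply pow_le_pow_left₀ (by linarith)
            have := Real.add_one_le_exp (-p)
            linarith
        _ = Real.exp (-(p * k)) := by rw [← Real.exp_nat_mul]; congr 1; ring
        _ ≤ _ := Real.exp_le_exp.2 (by linarith)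
    calc (n : ℝ) * (n * (1 - p) ^ k) ≤ n * (n * Real.exp (-(10 * x))) := by gcongr
      _ = Real.exp (-(8 * x)) := by
          rw [← hnx, ← Real.exp_add, ← Real.exp_add]; congr 1; ring
      _ ≤ Real.exp (-2) := Real.exp_le_exp.2 (by linarith)
      _ < 1 / 4 := by
          rw [Real.exp_neg, ← one_div]
          exact one_div_lt_one_div_of_lt (by norm_num) e4
  linarith

end Jigsaw


open MeasureTheory Filter Topology

/-- For connected puzzles of maximum degree at most `D` and an
Erdős–Rényi people graph, the critical value satisfies `p_c(n) ≤ C / log n` for large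
`n` and `n^b · p_c(n) → ∞` for every `b > 0`. -/
theorem jigsaw_bounded_degree_critical (D : ℕ) (hD : 1 ≤ D)
    (P : (n : ℕ) → SimpleGraph (Fin n)) (hconn : ∀ n, 0 < n → (P n).Connected)
    (hdeg : ∀ n, ∀ v : Fin n, ((P n).neighborSet v).ncard ≤ D)
    (pc : ℕ → ℝ)
    (hpc : ∀ n, 2 ≤ n → pc n ∈ Set.Ioo (0 : ℝ) 1 ∧
      Jigsaw.erMeasure (Fin n) (pc n)
        {ω | Jigsaw.Solves (Jigsaw.graphOf ω) (P n)} = 1 / 2) :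
    (∃ C : ℝ, ∀ᶠ n : ℕ in atTop, pc n ≤ C / Real.log n) ∧
      (∀ b : ℝ, 0 < b → Tendsto (fun n : ℕ => (n : ℝ) ^ b * pc n) atTop atTop) := by
  have hreal : ∀ n, 2 ≤ n → (Jigsaw.erMeasure (Fin n) (pc n)).real
      {ω | Jigsaw.Solves (Jigsaw.graphOf ω) (P n)} = 1 / 2 := by
    intro n hn
    rw [Measure.real, (hpc n hn).2]
    simp
  have hlog : Tendsto (fun n : ℕ => Real.log n) atTop atTop :=
    Real.tendsto_log_atTop.comp tendsto_natCast_atTop_atTop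
  constructor
  · refine ⟨10, ?_⟩
    filter_upwards [eventually_ge_atTop 2, hlog.eventually (Jigsaw.ev_poly D),
      hlog.eventually (eventually_ge_atTop 25)] with n hn hpoly h25
    by_contra hcon
    push Not at hcon
    have h := Jigsaw.upper_bound hD (hconn n (by omega)) (hdeg n) (hpc n hn).1.2.le h25 hpoly hcon
    have hcompl := measureReal_compl (μ := Jigsaw.erMeasure (Fin n) (pc n))
      (s := {ω | Jigsaw.Solves (Jigsaw.graphOf ω) (P n)}) (Set.toFinite _).measurableSet
    rw [hreal n hn, probReal_univ] at hcompl
    have he : {ω | ¬ Jigsaw.Solves (Jigsaw.graphOf ω) (P n)} =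
      {ω | Jigsaw.Solves (Jigsaw.graphOf ω) (P n)}ᶜ := rfl
    rw [he, hcompl] at h
    norm_num at h
  · intro b hb
    rw [tendsto_atTop]
    intro K₀
    set K := max K₀ 1 with hK
    have hK1 : 1 ≤ K := le_max_right _ _
    obtain ⟨t, ht⟩ := exists_nat_gt (2 / b)
    have ht' : 2 < b * t := by
      rw [div_lt_iff₀ hb] at ht; linarith
    have ht0 : t ≠ 0 := by
      rintro rfl
      simp at ht'
      linarith
    set l := t + 1 with hl
    set c : ℝ := (2 : ℝ) ^ (((D + 1) ^ (2 * l) + 1).choose 2) with hc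
    have hc0 : 0 < c := by positivity
    filter_upwards [eventually_ge_atTop 2, eventually_ge_atTop l,
      tendsto_natCast_atTop_atTop.eventually (eventually_gt_atTop (2 * (c * K ^ t)))] with n hn hnl hbig
    by_contra hcon
    push Not at hcon
    have hn1 : (1 : ℝ) ≤ n := by exact_mod_cast (by omega : 1 ≤ n)
    have hn0 : (0 : ℝ) < n := by linarith
    have hp0 := (hpc n hn).1.1
    have h := Jigsaw.solve_prob_le (hdeg n) (l := l) (by omega) (by simpa using hnl)
      hp0.le (hpc n hn).1.2.le
    rw [hreal n hn, Fintype.card_fin, ← hc, hl, Nat.add_sub_cancel] at h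
    have h2 : ((n : ℝ) ^ b * pc n) ^ t ≤ K ^ t := by
      apply pow_le_pow_left₀ (by positivity)
      exact hcon.le.trans (le_max_left _ _)
    have h3 : (n : ℝ) ^ 2 ≤ ((n : ℝ) ^ b) ^ t := by
      rw [← Real.rpow_mul_natCast hn0.le, ← Real.rpow_natCast]
      apply Real.rpow_le_rpow_of_exponent_le hn1
      push_cast
      exact ht'.le
    rw [mul_pow] at h2
    have h4 : (n : ℝ) ^ 2 * pc n ^ t ≤ K ^ t :=
      le_trans (mul_le_mul_of_nonneg_right h3 (by positivity)) h2
    have h5 : (n : ℝ) * (n * (c * pc n ^ t)) ≤ c * K ^ t := by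
      calc (n : ℝ) * (n * (c * pc n ^ t)) = c * ((n : ℝ) ^ 2 * pc n ^ t) := by ring
        _ ≤ c * K ^ t := by gcongr
    have h6 : (n : ℝ) * (1 / 2) ≤ n * (n * (c * pc n ^ t)) := by gcongr
    linarith
end

section
/- Let the puzzle graph be any connected simple graph on n vertices and let the people graph be the Erdős–Rényi random graph G(n, p_n) with p_n ∈ (0,1). Fix δ > 0 and set ε_n := −log(1 − p_n). Let A be the event that there exists an internally solved subset of V of size at least (1+δ) log n / ε_n. Then P_{p_n}(Solve | A) ≥ 1 − n^{−δ} (equivalently, P_{p_n}(Solve ∩ A) ≥ (1 − n^{−δ}) · P_{p_n}(A)). -/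
open MeasureTheory Filter Topology

open MeasureTheory Filter Topology

namespace Jigsaw

section Deterministic

variable {V : Type*}

lemma clusters_partition (Gpe Gpu : SimpleGraph V) (i : ℕ) :
    (∀ B ∈ clusters Gpe Gpu i, B.Nonempty) ∧
    (∀ v : V, ∃ B ∈ clusters Gpe Gpu i, v ∈ B) ∧
    (∀ B ∈ clusters Gpe Gpu i, ∀ B' ∈ clusters Gpe Gpu i, ∀ v, v ∈ B → v ∈ B' → B = B') := by
  induction i with
  | zero =>
    refine ⟨?_, ?_, ?_⟩
    · rintro B ⟨v, rfl⟩; exact ⟨v, rfl⟩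
    · intro v; exact ⟨{v}, ⟨v, rfl⟩, rfl⟩
    · rintro B ⟨v, rfl⟩ B' ⟨v', rfl⟩ w hw hw'
      rw [Set.mem_singleton_iff] at hw hw'
      rw [← hw, ← hw']
  | succ i ih =>
    obtain ⟨h1, h2, h3⟩ := ih
    refine ⟨?_, ?_, ?_⟩
    · rintro B ⟨cc, rfl⟩
      induction cc using SimpleGraph.ConnectedComponent.ind with
      | h U =>
        obtain ⟨x, hx⟩ := h1 U.1 U.2
        exact ⟨x, U.1, ⟨U.2, rfl⟩, hx⟩
    · intro v
      obtain ⟨B, hB, hv⟩ := h2 v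
      exact ⟨_, ⟨(clusterGraph Gpe Gpu _).connectedComponentMk ⟨B, hB⟩, rfl⟩,
        B, ⟨hB, rfl⟩, hv⟩
    · rintro B ⟨cc, rfl⟩ B' ⟨cc', rfl⟩ w ⟨U, ⟨hU, hUc⟩, hw⟩ ⟨U', ⟨hU', hUc'⟩, hw'⟩
      obtain rfl := h3 U hU U' hU' w hw hw'
      have : cc = cc' := hUc.symm.trans hUc'
      rw [this]

lemma solves_of_univ_mem {Gpe Gpu : SimpleGraph V} {i : ℕ}
    (h : Set.univ ∈ clusters Gpe Gpu i) : Solves Gpe Gpu := by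
  obtain ⟨h1, _, h3⟩ := clusters_partition Gpe Gpu i
  refine ⟨i, ?_⟩
  ext B
  rw [Set.mem_singleton_iff]
  constructor
  · intro hB
    obtain ⟨x, hx⟩ := h1 B hB
    exact h3 B hB _ h x hx (Set.mem_univ x)
  · rintro rfl; exact h

/-- Blocks reachable from each other merge into a common block. -/
lemma step_mem (Gpe Gpu : SimpleGraph V) (C : Set (Set V)) (U : C) :
    ∃ B ∈ step Gpe Gpu C, ∀ W : C, (clusterGraph Gpe Gpu C).Reachable W U → W.1 ⊆ B := by
  refine ⟨_, ⟨(clusterGraph Gpe Gpu C).connectedComponentMk U, rfl⟩, ?_⟩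
  intro W hW x hx
  exact ⟨W.1, ⟨W.2, SimpleGraph.ConnectedComponent.eq.2 hW⟩, hx⟩

lemma clusters_map {V' : Type*} {Gpe Gpu : SimpleGraph V} {Hpe Hpu : SimpleGraph V'} (f : V → V')
    (hpe : ∀ u w, Gpe.Adj u w → Hpe.Adj (f u) (f w))
    (hpu : ∀ u w, Gpu.Adj u w → Hpu.Adj (f u) (f w)) (i : ℕ) :
    ∀ B ∈ clusters Gpe Gpu i, ∃ B' ∈ clusters Hpe Hpu i, ∀ x ∈ B, f x ∈ B' := by
  induction i with
  | zero =>
    rintro B ⟨v, rfl⟩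
    refine ⟨{f v}, ⟨f v, rfl⟩, ?_⟩
    rintro x rfl; rfl
  | succ i ih =>
    choose g hg hgs using ih
    rintro B ⟨cc, rfl⟩
    induction cc using SimpleGraph.ConnectedComponent.ind with
    | h U =>
      let g' : clusters Gpe Gpu i → clusters Hpe Hpu i := fun W => ⟨g W.1 W.2, hg W.1 W.2⟩
      obtain ⟨B', hB', hs⟩ := step_mem Hpe Hpu (clusters Hpe Hpu i) (g' U)
      refine ⟨B', hB', ?_⟩
      rintro x ⟨W, ⟨hW, hc⟩, hx⟩
      refine hs (g' ⟨W, hW⟩) ?_ (hgs W hW x hx)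
      obtain ⟨walk⟩ := SimpleGraph.ConnectedComponent.eq.1 hc
      clear hc hx hs
      generalize (⟨W, hW⟩ : clusters Gpe Gpu i) = W' at walk
      induction walk with
      | nil => exact SimpleGraph.Reachable.refl _
      | cons hadj _ ih2 =>
        rename_i a b c _
        refine SimpleGraph.Reachable.trans ?_ ih2
        by_cases hab : g' a = g' b
        · rw [hab]
        · refine SimpleGraph.Adj.reachable ⟨hab, ?_, ?_⟩
          · obtain ⟨_, ⟨u, hu, w, hw, h⟩, _⟩ := hadj
            exact ⟨f u, hgs _ _ _ hu, f w, hgs _ _ _ hw, hpe _ _ h⟩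
          · obtain ⟨_, _, ⟨u, hu, w, hw, h⟩⟩ := hadj
            exact ⟨f u, hgs _ _ _ hu, f w, hgs _ _ _ hw, hpu _ _ h⟩

lemma solves_of_internallySolved_univ {Gpe Gpu : SimpleGraph V}
    (h : InternallySolved Gpe Gpu Set.univ) : Solves Gpe Gpu := by
  obtain ⟨i, hi⟩ := h
  obtain ⟨B, hB, hs⟩ := clusters_map (Hpe := Gpe) (Hpu := Gpu)
    (fun x : (Set.univ : Set V) => x.1)
    (fun u w h => h) (fun u w h => h) i Set.univ (by rw [hi]; rfl)
  have : B = Set.univ := Set.eq_univ_of_forall fun x => hs ⟨x, trivial⟩ trivial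
  exact solves_of_univ_mem (this ▸ hB)

lemma internallySolved_insert {Gpe Gpu : SimpleGraph V} {U : Set V} {v : V}
    (h : InternallySolved Gpe Gpu U) (hpe : ∃ u ∈ U, Gpe.Adj u v) (hpu : ∃ u ∈ U, Gpu.Adj u v) :
    InternallySolved Gpe Gpu (insert v U) := by
  obtain ⟨i, hi⟩ := h
  obtain ⟨B, hB, hs⟩ := clusters_map (Hpe := SimpleGraph.induce (insert v U) Gpe)
    (Hpu := SimpleGraph.induce (insert v U) Gpu)
    (fun x : U => (⟨x.1, Or.inr x.2⟩ : (insert v U : Set V)))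
    (fun u w h => h) (fun u w h => h) i Set.univ (by rw [hi]; rfl)
  obtain ⟨_, h2, _⟩ := clusters_partition (SimpleGraph.induce (insert v U) Gpe)
    (SimpleGraph.induce (insert v U) Gpu) i
  obtain ⟨B2, hB2, hv⟩ := h2 ⟨v, Or.inl rfl⟩
  obtain ⟨B3, hB3, h3⟩ := step_mem (SimpleGraph.induce (insert v U) Gpe)
    (SimpleGraph.induce (insert v U) Gpu) _ (⟨B2, hB2⟩ : clusters (SimpleGraph.induce (insert v U) Gpe)
    (SimpleGraph.induce (insert v U) Gpu) i)
  have e : B3 = Set.univ := by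
    refine Set.eq_univ_of_forall ?_
    rintro ⟨x, rfl | hx⟩
    · exact h3 _ (SimpleGraph.Reachable.refl _) hv
    · refine h3 ⟨B, hB⟩ ?_ (hs ⟨x, hx⟩ trivial)
      by_cases hBB : (⟨B, hB⟩ : clusters (SimpleGraph.induce (insert v U) Gpe)
          (SimpleGraph.induce (insert v U) Gpu) i) = ⟨B2, hB2⟩
      · rw [hBB]
      · obtain ⟨u, hu, hua⟩ := hpe
        obtain ⟨w, hw, hwa⟩ := hpu
        exact SimpleGraph.Adj.reachable ⟨hBB, ⟨_, hs ⟨u, hu⟩ trivial, _, hv, hua⟩,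
          ⟨_, hs ⟨w, hw⟩ trivial, _, hv, hwa⟩⟩
  exact solves_of_univ_mem (i := i + 1) (e ▸ hB3)

lemma exists_boundary {G : SimpleGraph V} (hG : G.Connected) {W : Set V} (hne : W.Nonempty)
    (hW : W ≠ Set.univ) : ∃ v, v ∉ W ∧ ∃ u ∈ W, G.Adj u v := by
  obtain ⟨a, ha⟩ := hne
  obtain ⟨b, hb⟩ := (Set.ne_univ_iff_exists_notMem W).1 hW
  obtain ⟨w⟩ := hG.preconnected a b
  obtain ⟨d, _, h1, h2⟩ := w.exists_boundary_dart W ha hb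
  exact ⟨d.snd, h2, d.fst, h1, d.adj⟩

lemma induce_graphOf_congr {ω ω' : Sym2 V → Bool} {v : V} {U : Set V} (hv : v ∉ U)
    (h : ∀ e : Sym2 V, v ∉ e → ω e = ω' e) :
    SimpleGraph.induce U (graphOf ω) = SimpleGraph.induce U (graphOf ω') := by
  ext a b
  have : ω s(a.1, b.1) = ω' s(a.1, b.1) := by
    apply h
    rw [Sym2.mem_iff]
    rintro (rfl | rfl)
    · exact hv a.2
    · exact hv b.2
  simp [graphOf, this]

end Deterministic

section Probability

variable {n : ℕ}

/-- An injective ranking of vertex sets which refines cardinality. -/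
noncomputable def rank (U : Set (Fin n)) : ℕ :=
  U.ncard * Fintype.card (Set (Fin n)) + (Fintype.equivFin (Set (Fin n)) U).1

lemma rank_lt {U W : Set (Fin n)} (h : U.ncard < W.ncard) : rank U < rank W := by
  unfold rank
  have h1 := (Fintype.equivFin (Set (Fin n)) U).2
  have h2 : (U.ncard + 1) * Fintype.card (Set (Fin n)) ≤
    W.ncard * Fintype.card (Set (Fin n)) := Nat.mul_le_mul_right _ h
  rw [Nat.add_mul, Nat.one_mul] at h2
  omega

lemma rank_inj {U W : Set (Fin n)} (h : rank U = rank W) : U = W := by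
  have hc : U.ncard = W.ncard := by
    rcases lt_trichotomy U.ncard W.ncard with h1 | h1 | h1
    · have := rank_lt h1; omega
    · exact h1
    · have := rank_lt h1; omega
  unfold rank at h
  rw [hc] at h
  exact (Fintype.equivFin (Set (Fin n))).injective (Fin.ext (by omega))

/-- `U` is the best internally solved set avoiding `v`. -/
def Best (Gpu : SimpleGraph (Fin n)) (v : Fin n) (U : Set (Fin n)) : Set (Sym2 (Fin n) → Bool) :=
  {ω | InternallySolved (graphOf ω) Gpu U ∧ ∀ U' : Set (Fin n), v ∉ U' →
    InternallySolved (graphOf ω) Gpu U' → rank U' ≤ rank U}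

/-- `v` has no people edge to `U`. -/
def NoEdge (v : Fin n) (U : Set (Fin n)) : Set (Sym2 (Fin n) → Bool) :=
  {ω | ∀ u ∈ U, ω s(u, v) = false}

lemma best_congr {Gpu : SimpleGraph (Fin n)} {v : Fin n} {U : Set (Fin n)} (hv : v ∉ U)
    {ω ω' : Sym2 (Fin n) → Bool} (h : ∀ e : Sym2 (Fin n), v ∉ e → ω e = ω' e)
    (hω : ω ∈ Best Gpu v U) : ω' ∈ Best Gpu v U := by
  obtain ⟨h1, h2⟩ := hω
  refine ⟨?_, fun U' hU' hI => h2 U' hU' ?_⟩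
  · unfold InternallySolved at *
    rwa [← induce_graphOf_congr hv h]
  · unfold InternallySolved at *
    rwa [induce_graphOf_congr hU' h]

lemma bad_subset {Gpu : SimpleGraph (Fin n)} (hconn : Gpu.Connected) {κ : ℝ} (hκ : 0 < κ)
    {ω : Sym2 (Fin n) → Bool}
    (hA : ∃ U : Set (Fin n), κ ≤ (U.ncard : ℝ) ∧ InternallySolved (graphOf ω) Gpu U)
    (hS : ¬ Solves (graphOf ω) Gpu) :
    ∃ v : Fin n, ∃ U : Set (Fin n), v ∉ U ∧ κ ≤ (U.ncard : ℝ) ∧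
      ω ∈ Best Gpu v U ∩ NoEdge v U := by
  obtain ⟨U₀, hU₀, hI₀⟩ := hA
  obtain ⟨W, hW, hmax⟩ := Set.exists_max_image
    {U : Set (Fin n) | InternallySolved (graphOf ω) Gpu U} rank (Set.toFinite _) ⟨U₀, hI₀⟩
  have hcard : κ ≤ (W.ncard : ℝ) := by
    refine hU₀.trans ?_
    by_contra hlt
    have := rank_lt (n := n) (by exact_mod_cast (not_le.1 hlt) : W.ncard < U₀.ncard)
    have := hmax U₀ hI₀
    omega
  have hne : W.Nonempty := by
    rw [← Set.ncard_pos]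
    exact_mod_cast hκ.trans_le hcard
  have huniv : W ≠ Set.univ := by
    rintro rfl
    exact hS (solves_of_internallySolved_univ hW)
  obtain ⟨v, hv, hpu⟩ := exists_boundary hconn hne huniv
  refine ⟨v, W, hv, hcard, ⟨hW, fun U' _ hI => hmax U' hI⟩, ?_⟩
  intro u hu
  by_contra hadj
  have hins : InternallySolved (graphOf ω) Gpu (insert v W) := by
    refine internallySolved_insert hW ⟨u, hu, ?_, by simpa using hadj⟩ hpu
    rintro rfl; exact hv hu
  have h1 := hmax _ hins
  have h2 : rank W < rank (insert v W) := rank_lt (by rw [Set.ncard_insert_of_notMem hv]; omega)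
  omega

instance (p : ℝ) : IsProbabilityMeasure (erMeasure (Fin n) p) := by
  unfold erMeasure; infer_instance

lemma measurable_all (s : Set (Sym2 (Fin n) → Bool)) : MeasurableSet s :=
  (Set.toFinite s).measurableSet

lemma bern_false {p : ℝ} (hp : p ∈ Set.Ioo (0 : ℝ) 1) :
    (PMF.bernoulli (min (Real.toNNReal p) 1) (min_le_right _ _)).toMeasure {false}
      = ENNReal.ofReal (1 - p) := by
  rw [PMF.toMeasure_apply_singleton _ _ (measurableSet_singleton _)]
  have : min (Real.toNNReal p) 1 = Real.toNNReal p :=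
    min_eq_left (by rw [Real.toNNReal_le_one]; exact hp.2.le)
  simp only [PMF.bernoulli_apply, this]
  rw [ENNReal.ofReal_sub _ hp.1.le]
  simp [ENNReal.ofReal]

lemma measure_noEdge {p : ℝ} (hp : p ∈ Set.Ioo (0 : ℝ) 1) (v : Fin n) (U : Set (Fin n)) :
    erMeasure (Fin n) p (NoEdge v U) = ENNReal.ofReal (1 - p) ^ U.ncard := by
  classical
  have hset : NoEdge v U = Set.pi Set.univ
      (fun e => if e ∈ U.toFinset.image (fun u => s(u, v)) then ({false} : Set Bool)
        else Set.univ) := by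
    ext ω
    simp only [NoEdge, Set.mem_setOf_eq, Set.mem_pi, Set.mem_univ, forall_true_left]
    constructor
    · intro h e
      split_ifs with he
      · obtain ⟨u, hu, rfl⟩ := Finset.mem_image.1 he
        exact h u (by simpa using hu)
      · trivial
    · intro h u hu
      have := h s(u, v)
      rw [if_pos (Finset.mem_image.2 ⟨u, by simpa using hu, rfl⟩)] at this
      exact this
  rw [hset, erMeasure, Measure.pi_pi]
  have : ∀ e : Sym2 (Fin n), (PMF.bernoulli (min (Real.toNNReal p) 1)
      (min_le_right _ _)).toMeasure (if e ∈ U.toFinset.image (fun u => s(u, v))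
        then ({false} : Set Bool) else Set.univ) =
      if e ∈ U.toFinset.image (fun u => s(u, v)) then ENNReal.ofReal (1 - p) else 1 := by
    intro e
    split_ifs
    · exact bern_false hp
    · exact measure_univ
  rw [Finset.prod_congr rfl fun e _ => this e]
  rw [Finset.prod_ite_mem, Finset.univ_inter, Finset.prod_const, Finset.card_image_of_injective,
    Set.ncard_eq_toFinset_card']
  intro a b hab
  exact Sym2.congr_left.1 hab

lemma measure_inter {p : ℝ} (Gpu : SimpleGraph (Fin n)) (v : Fin n)
    (U : Set (Fin n)) (hv : v ∉ U) :
    erMeasure (Fin n) p (Best Gpu v U ∩ NoEdge v U) =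
      erMeasure (Fin n) p (Best Gpu v U) * erMeasure (Fin n) p (NoEdge v U) := by
  classical
  have hind : ProbabilityTheory.iIndepFun (fun (e : Sym2 (Fin n)) (ω : Sym2 (Fin n) → Bool) => ω e)
      (erMeasure (Fin n) p) := by
    unfold erMeasure
    exact ProbabilityTheory.iIndepFun_pi (X := fun _ b => b) (fun _ => aemeasurable_id)
  let S : Finset (Sym2 (Fin n)) := Finset.univ.filter fun e => v ∉ e
  let T : Finset (Sym2 (Fin n)) := Finset.univ.filter fun e => v ∈ e
  have hd : Disjoint S T := by
    rw [Finset.disjoint_left]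
    intro e h1 h2
    exact (Finset.mem_filter.1 h1).2 (Finset.mem_filter.1 h2).2
  have h := hind.indepFun_finset S T hd (fun e => measurable_pi_apply e)
  have key := h.measure_inter_preimage_eq_mul
    ((fun ω (e : S) => ω e.1) '' Best Gpu v U) ((fun ω (e : T) => ω e.1) '' NoEdge v U)
    (Set.toFinite _).measurableSet (Set.toFinite _).measurableSet
  have e1 : (fun (ω : Sym2 (Fin n) → Bool) (e : S) => ω e.1) ⁻¹'
      ((fun ω (e : S) => ω e.1) '' Best Gpu v U) = Best Gpu v U := by
    refine Set.Subset.antisymm ?_ (Set.subset_preimage_image _ _)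
    rintro ω ⟨ω', hω', heq⟩
    refine best_congr hv (fun e he => ?_) hω'
    exact congrFun heq ⟨e, by simp [S, he]⟩
  have e2 : (fun (ω : Sym2 (Fin n) → Bool) (e : T) => ω e.1) ⁻¹'
      ((fun ω (e : T) => ω e.1) '' NoEdge v U) = NoEdge v U := by
    refine Set.Subset.antisymm ?_ (Set.subset_preimage_image _ _)
    rintro ω ⟨ω', hω', heq⟩ u hu
    rw [← hω' u hu]
    exact (congrFun heq ⟨s(u, v), by simp [T]⟩).symm
  rw [e1, e2] at key
  exact key

lemma measure_bad_le {Gpu : SimpleGraph (Fin n)} (hconn : Gpu.Connected) {κ : ℝ} (hκ : 0 < κ)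
    {p : ℝ} (hp : p ∈ Set.Ioo (0 : ℝ) 1) :
    erMeasure (Fin n) p
      ({ω | ∃ U : Set (Fin n), κ ≤ (U.ncard : ℝ) ∧ InternallySolved (graphOf ω) Gpu U} \
        {ω | Solves (graphOf ω) Gpu}) ≤
    n * (ENNReal.ofReal ((1 - p) ^ κ) * erMeasure (Fin n) p
      {ω | ∃ U : Set (Fin n), κ ≤ (U.ncard : ℝ) ∧ InternallySolved (graphOf ω) Gpu U}) := by
  classical
  set A : Set (Sym2 (Fin n) → Bool) :=
    {ω | ∃ U : Set (Fin n), κ ≤ (U.ncard : ℝ) ∧ InternallySolved (graphOf ω) Gpu U} with hA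
  let F : Fin n → Finset (Set (Fin n)) := fun v =>
    Finset.univ.filter fun U => v ∉ U ∧ κ ≤ (U.ncard : ℝ)
  have hsub : A \ {ω | Solves (graphOf ω) Gpu} ⊆
      ⋃ v ∈ (Finset.univ : Finset (Fin n)), ⋃ U ∈ F v, Best Gpu v U ∩ NoEdge v U := by
    rintro ω ⟨h1, h2⟩
    obtain ⟨v, U, hv, hU, h⟩ := bad_subset hconn hκ h1 h2
    simp only [Set.mem_iUnion]
    exact ⟨v, Finset.mem_univ _, U, by simp [F, hv, hU], h⟩
  have hv : ∀ v : Fin n, erMeasure (Fin n) p (⋃ U ∈ F v, Best Gpu v U ∩ NoEdge v U) ≤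
      ENNReal.ofReal ((1 - p) ^ κ) * erMeasure (Fin n) p A := by
    intro v
    calc _ ≤ ∑ U ∈ F v, erMeasure (Fin n) p (Best Gpu v U ∩ NoEdge v U) :=
          measure_biUnion_finset_le _ _
      _ ≤ ∑ U ∈ F v, ENNReal.ofReal ((1 - p) ^ κ) * erMeasure (Fin n) p (Best Gpu v U) := by
          refine Finset.sum_le_sum fun U hU => ?_
          obtain ⟨hvU, hc⟩ := (Finset.mem_filter.1 hU).2
          rw [measure_inter Gpu v U hvU, measure_noEdge hp, mul_comm]
          gcongr
          rw [← ENNReal.ofReal_pow (by linarith [hp.2])]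
          apply ENNReal.ofReal_le_ofReal
          rw [← Real.rpow_natCast]
          exact Real.rpow_le_rpow_of_exponent_ge (by linarith [hp.2]) (by linarith [hp.1]) hc
      _ = ENNReal.ofReal ((1 - p) ^ κ) * erMeasure (Fin n) p (⋃ U ∈ F v, Best Gpu v U) := by
          rw [← Finset.mul_sum, measure_biUnion_finset _ fun _ _ => measurable_all _]
          intro U hU U' hU' hne
          refine Set.disjoint_left.2 ?_
          rintro ω ⟨a1, a2⟩ ⟨b1, b2⟩
          have hvU := (Finset.mem_filter.1 hU).2.1
          have hvU' := (Finset.mem_filter.1 hU').2.1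
          exact hne (rank_inj (le_antisymm (b2 U hvU a1) (a2 U' hvU' b1)))
      _ ≤ _ := by
          gcongr
          refine Set.iUnion₂_subset fun U hU ω hω => ?_
          exact ⟨U, (Finset.mem_filter.1 hU).2.2, hω.1⟩
  calc _ ≤ _ := measure_mono hsub
    _ ≤ ∑ v : Fin n, erMeasure (Fin n) p (⋃ U ∈ F v, Best Gpu v U ∩ NoEdge v U) :=
        measure_biUnion_finset_le _ _
    _ ≤ ∑ v : Fin n, ENNReal.ofReal ((1 - p) ^ κ) * erMeasure (Fin n) p A :=
        Finset.sum_le_sum fun v _ => hv v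
    _ = _ := by simp

end Probability

end Jigsaw

/-- If `A` is the event that some internally solved subset of size at
least `(1+δ) log n / ε_n` exists (with `ε_n = -log(1-p)`), then
`P(Solve ∩ A) ≥ (1 - n^{-δ}) P(A)`. -/
theorem jigsaw_internally_solved_implies_solve (n : ℕ) (Gpu : SimpleGraph (Fin n))
    (hconn : Gpu.Connected) (p : ℝ) (hp : p ∈ Set.Ioo (0 : ℝ) 1)
    (delta : ℝ) (hdelta : 0 < delta) :
    Jigsaw.erMeasure (Fin n) p
        ({ω | Jigsaw.Solves (Jigsaw.graphOf ω) Gpu} ∩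
          {ω | ∃ U : Set (Fin n),
            (1 + delta) * Real.log n / (-Real.log (1 - p)) ≤ (U.ncard : ℝ) ∧
            Jigsaw.InternallySolved (Jigsaw.graphOf ω) Gpu U})
      ≥ ENNReal.ofReal (1 - (n : ℝ) ^ (-delta)) *
        Jigsaw.erMeasure (Fin n) p
          {ω | ∃ U : Set (Fin n),
            (1 + delta) * Real.log n / (-Real.log (1 - p)) ≤ (U.ncard : ℝ) ∧
            Jigsaw.InternallySolved (Jigsaw.graphOf ω) Gpu U} := by
  have hn0 : n ≠ 0 := by
    rintro rfl
    exact hconn.nonempty.elim fun x => x.elim0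
  rcases Nat.lt_or_ge 1 n with hn | hn
  swap
  · obtain rfl : n = 1 := by omega
    simp
  have hnR : (1 : ℝ) < n := by exact_mod_cast hn
  have hlogn : 0 < Real.log n := Real.log_pos hnR
  have hlog : Real.log (1 - p) < 0 := Real.log_neg (by linarith [hp.2]) (by linarith [hp.1])
  set κ : ℝ := (1 + delta) * Real.log n / (-Real.log (1 - p)) with hκdef
  have hκ : 0 < κ := by
    apply div_pos (by positivity); linarith
  have hbad := Jigsaw.measure_bad_le hconn hκ hp
  set A : Set (Sym2 (Fin n) → Bool) := {ω | ∃ U : Set (Fin n), κ ≤ (U.ncard : ℝ) ∧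
    Jigsaw.InternallySolved (Jigsaw.graphOf ω) Gpu U} with hA
  set S : Set (Sym2 (Fin n) → Bool) := {ω | Jigsaw.Solves (Jigsaw.graphOf ω) Gpu} with hS
  have hpow : (n : ℝ) * (1 - p) ^ κ = (n : ℝ) ^ (-delta) := by
    have h1 : (1 - p) ^ κ = (n : ℝ) ^ (-(1 + delta)) := by
      rw [Real.rpow_def_of_pos (by linarith [hp.2]), Real.rpow_def_of_pos (by linarith)]
      congr 1
      have hne : Real.log (1 - p) ≠ 0 := hlog.ne
      rw [hκdef]
      field_simp
    rw [h1]
    nth_rewrite 1 [← Real.rpow_one (n : ℝ)]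
    rw [← Real.rpow_add (by linarith)]
    congr 1
    ring
  have hx : (n : ENNReal) * ENNReal.ofReal ((1 - p) ^ κ) = ENNReal.ofReal ((n : ℝ) ^ (-delta)) := by
    rw [← hpow, ENNReal.ofReal_mul (by positivity), ENNReal.ofReal_natCast]
  rw [← mul_assoc, hx] at hbad
  have hsplit : Jigsaw.erMeasure (Fin n) p A ≤ Jigsaw.erMeasure (Fin n) p (S ∩ A) +
      ENNReal.ofReal ((n : ℝ) ^ (-delta)) * Jigsaw.erMeasure (Fin n) p A := by
    rw [← measure_inter_add_diff A (Jigsaw.measurable_all S), Set.inter_comm A S] 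
    gcongr
    rw [Set.inter_comm S A, measure_inter_add_diff A (Jigsaw.measurable_all S)]
    exact hbad
  rw [ge_iff_le, ENNReal.ofReal_sub _ (by positivity), ENNReal.ofReal_one,
    ENNReal.sub_mul (fun _ _ => measure_ne_top _ _), one_mul]
  exact tsub_le_iff_right.2 hsplit
end

section
/- Define θ(x) := −∫₀^x log(1 − e^{−t}) dt for x ∈ [0, ∞]. Let (m_ε) be natural numbers indexed by ε > 0 such that m_ε · ε → x ∈ [0, ∞] as ε → 0⁺. Then ε · Σ_{i=1}^{m_ε} log(1 − e^{−iε}) → −θ(x) as ε → 0⁺. -/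
open MeasureTheory Filter Topology

open MeasureTheory Filter Topology

/-- `θ(x) = -∫₀ˣ log(1 - e^{-t}) dt` for `x ∈ [0, ∞]`, the integral being over
`{t : ℝ | 0 < t ∧ t < x}` (all of `(0,∞)` when `x = ∞`). -/
noncomputable def theta (x : ENNReal) : ℝ :=
  -∫ t in {t : ℝ | 0 < t ∧ ENNReal.ofReal t < x}, Real.log (1 - Real.exp (-t))


lemma aux_nonpos {t : ℝ} (ht : 0 < t) : Real.log (1 - Real.exp (-t)) ≤ 0 := by
  have h1 : Real.exp (-t) < 1 := Real.exp_lt_one_iff.2 (by linarith)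
  exact Real.log_nonpos (by linarith) (by linarith [Real.exp_pos (-t)])

lemma aux_mono {s t : ℝ} (hs : 0 < s) (hst : s ≤ t) :
    Real.log (1 - Real.exp (-s)) ≤ Real.log (1 - Real.exp (-t)) := by
  have h1 : Real.exp (-s) < 1 := Real.exp_lt_one_iff.2 (by linarith)
  have h2 : Real.exp (-t) ≤ Real.exp (-s) := Real.exp_le_exp.2 (by linarith)
  exact Real.log_le_log (by linarith) (by linarith)

lemma aux_meas : Measurable (fun t : ℝ => Real.log (1 - Real.exp (-t))) := by
  fun_prop

lemma aux_int : IntegrableOn (fun t : ℝ => Real.log (1 - Real.exp (-t))) (Set.Ioi 0) := by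
  rw [← Set.Ioc_union_Ioi_eq_Ioi (zero_le_one (α := ℝ)), integrableOn_union]
  constructor
  · have h : IntegrableOn (fun t : ℝ => -Real.log t + t) (Set.Ioc 0 1) := by
      have h1 : IntervalIntegrable (fun t : ℝ => -Real.log t + t) volume 0 1 :=
        (intervalIntegral.intervalIntegrable_log').neg.add
          (continuous_id.intervalIntegrable 0 1)
      exact (intervalIntegrable_iff_integrableOn_Ioc_of_le zero_le_one).1 h1
    refine Integrable.mono' h aux_meas.aestronglyMeasurable ?_
    refine (ae_restrict_iff' measurableSet_Ioc).2 (Eventually.of_forall fun t ht => ?_)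
    have ht0 : 0 < t := ht.1
    rw [Real.norm_eq_abs, abs_of_nonpos (aux_nonpos ht0)]
    have key : t * Real.exp (-t) ≤ 1 - Real.exp (-t) := by
      have := Real.add_one_le_exp t
      have h3 : Real.exp t * Real.exp (-t) = 1 := by rw [← Real.exp_add]; simp
      nlinarith [Real.exp_pos (-t)]
    have := Real.log_le_log (mul_pos ht0 (Real.exp_pos _)) key
    rw [Real.log_mul ht0.ne' (Real.exp_pos _).ne', Real.log_exp] at this
    linarith
  · have h : IntegrableOn (fun t : ℝ => (1 - Real.exp (-1))⁻¹ * Real.exp (-t)) (Set.Ioi 1) :=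
      (integrableOn_exp_neg_Ioi 1).const_mul _
    refine Integrable.mono' h aux_meas.aestronglyMeasurable ?_
    refine (ae_restrict_iff' measurableSet_Ioi).2 (Eventually.of_forall fun t ht => ?_)
    have ht1 : 1 < t := ht
    have ht0 : 0 < t := by linarith
    rw [Real.norm_eq_abs, abs_of_nonpos (aux_nonpos ht0)]
    have h1 : Real.exp (-t) ≤ Real.exp (-1) := Real.exp_le_exp.2 (by linarith)
    have h2 : Real.exp (-1) < 1 := Real.exp_lt_one_iff.2 (by linarith)
    have hp : 0 < 1 - Real.exp (-t) := by linarith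
    have h3 := Real.one_sub_inv_le_log_of_pos hp
    have h4 : (1 - Real.exp (-t))⁻¹ ≤ (1 - Real.exp (-1))⁻¹ :=
      inv_anti₀ (by linarith) (by linarith)
    have h5 : (1 - Real.exp (-t))⁻¹ - 1 = (1 - Real.exp (-t))⁻¹ * Real.exp (-t) := by
      field_simp; ring
    have h6 := mul_le_mul_of_nonneg_right h4 (Real.exp_pos (-t)).le
    linarith

lemma aux_ii {a b : ℝ} (ha : 0 ≤ a) (hab : a ≤ b) :
    IntervalIntegrable (fun t : ℝ => Real.log (1 - Real.exp (-t))) volume a b := by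
  rw [intervalIntegrable_iff_integrableOn_Ioc_of_le hab]
  exact aux_int.mono_set fun t ht => lt_of_le_of_lt ha ht.1

lemma theta_ofReal {a : ℝ} (ha : 0 ≤ a) :
    -theta (ENNReal.ofReal a) = ∫ t in (0:ℝ)..a, Real.log (1 - Real.exp (-t)) := by
  rw [theta, neg_neg, intervalIntegral.integral_of_le ha, integral_Ioc_eq_integral_Ioo]
  congr 2
  ext t
  simp only [Set.mem_setOf_eq, Set.mem_Ioo]
  refine and_congr_right fun ht => ?_
  rw [ENNReal.ofReal_lt_ofReal_iff_of_nonneg ht.le]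

lemma theta_set_meas (x : ENNReal) :
    MeasurableSet {t : ℝ | 0 < t ∧ ENNReal.ofReal t < x} :=
  (measurableSet_lt measurable_const measurable_id).inter
    (measurableSet_lt ENNReal.measurable_ofReal measurable_const)

lemma neg_theta_eq (x : ENNReal) : -theta x = ∫ t in Set.Ioi (0:ℝ),
    {t : ℝ | ENNReal.ofReal t < x}.indicator (fun t => Real.log (1 - Real.exp (-t))) t := by
  rw [theta, neg_neg, setIntegral_indicator
    (measurableSet_lt ENNReal.measurable_ofReal measurable_const)]
  rfl

lemma theta_cont : Continuous (fun x => -theta x) := by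
  simp only [neg_theta_eq]
  refine continuous_iff_continuousAt.2 fun x => ?_
  refine tendsto_integral_filter_of_dominated_convergence
    (fun t => ‖Real.log (1 - Real.exp (-t))‖) ?_ ?_ aux_int.norm ?_
  · exact Eventually.of_forall fun y => (aux_meas.indicator
      (measurableSet_lt ENNReal.measurable_ofReal measurable_const)).aestronglyMeasurable
  · exact Eventually.of_forall fun y => Eventually.of_forall fun t =>
      norm_indicator_le_norm_self _ _
  · have hne : ∀ᵐ t : ℝ ∂(volume.restrict (Set.Ioi 0)), t ≠ x.toReal :=
      ae_restrict_of_ae (Measure.ae_ne volume _)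
    filter_upwards [hne, ae_restrict_mem measurableSet_Ioi] with t ht ht0
    have ht0' : (0:ℝ) < t := ht0
    have hx : ENNReal.ofReal t ≠ x := by
      rintro rfl
      exact ht (ENNReal.toReal_ofReal ht0'.le).symm
    refine tendsto_const_nhds.congr' ?_
    rcases lt_or_gt_of_ne hx with h | h
    · filter_upwards [lt_mem_nhds h] with y hy
      simp [Set.indicator, h, hy]
    · filter_upwards [gt_mem_nhds h] with y hy
      simp [Set.indicator, h.not_gt, hy.not_gt]

lemma sum_bounds {ε : ℝ} (hε : 0 < ε) (m : ℕ) :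
    (∫ t in (0:ℝ)..(m * ε), Real.log (1 - Real.exp (-t))) ≤
      ε * ∑ i ∈ Finset.Icc 1 m, Real.log (1 - Real.exp (-((i : ℝ) * ε))) ∧
    ε * ∑ i ∈ Finset.Icc 1 m, Real.log (1 - Real.exp (-((i : ℝ) * ε))) ≤
      ∫ t in ε..(m * ε + ε), Real.log (1 - Real.exp (-t)) := by
  induction m with
  | zero => simp
  | succ k ih =>
    rw [Finset.sum_Icc_succ_top (by omega), mul_add]
    have hk : (0:ℝ) ≤ k * ε := by positivity
    have e : ((k + 1 : ℕ) : ℝ) * ε = k * ε + ε := by push_cast; ring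
    rw [e]
    rw [← intervalIntegral.integral_add_adjacent_intervals (aux_ii le_rfl hk)
      (aux_ii (b := k * ε + ε) hk (by linarith)),
      ← intervalIntegral.integral_add_adjacent_intervals
        (aux_ii (b := k * ε + ε) hε.le (by linarith))
      (aux_ii (b := k * ε + ε + ε) (by linarith) (by linarith))]
    refine ⟨add_le_add ih.1 ?_, add_le_add ih.2 ?_⟩
    · have := intervalIntegral.integral_mono_on_of_le_Ioo (μ := volume)
        (g := fun _ => Real.log (1 - Real.exp (-(k * ε + ε))))
        (by linarith) (aux_ii (b := k * ε + ε) hk (by linarith)) (by simp)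
        (fun t ht => aux_mono (lt_of_le_of_lt hk ht.1) ht.2.le)
      simpa using this
    · have := intervalIntegral.integral_mono_on_of_le_Ioo (μ := volume)
        (f := fun _ => Real.log (1 - Real.exp (-(k * ε + ε))))
        (by linarith) (by simp) (aux_ii (b := k * ε + ε + ε) (by linarith) (by linarith))
        (fun t ht => aux_mono (by linarith) ht.1.le)
      simpa using this

theorem sum_log_one_sub_exp_tendsto (x : ENNReal) (m : ℝ → ℕ)
    (hm : Tendsto (fun ε : ℝ => ENNReal.ofReal ((m ε : ℝ) * ε)) (𝓝[>] (0 : ℝ)) (𝓝 x)) :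
    Tendsto
      (fun ε : ℝ => ε * ∑ i ∈ Finset.Icc 1 (m ε), Real.log (1 - Real.exp (-((i : ℝ) * ε))))
      (𝓝[>] (0 : ℝ)) (𝓝 (-(theta x))) := by
  have hε : Tendsto (fun ε : ℝ => ENNReal.ofReal ε) (𝓝[>] (0 : ℝ)) (𝓝 0) := by
    have := (ENNReal.continuous_ofReal.tendsto 0).mono_left
      (nhdsWithin_le_nhds (s := Set.Ioi (0:ℝ)))
    simpa using this
  have h0 : theta 0 = 0 := by simp [theta]
  have hlow := (theta_cont.tendsto x).comp hm
  have hup := ((theta_cont.tendsto (x + 0)).comp (hm.add hε)).sub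
    ((theta_cont.tendsto 0).comp hε)
  rw [add_zero, h0, neg_zero, sub_zero] at hup
  refine tendsto_of_tendsto_of_tendsto_of_le_of_le' hlow hup ?_ ?_
  · filter_upwards [self_mem_nhdsWithin] with ε he
    have he' : (0:ℝ) < ε := he
    simp only [Function.comp]
    rw [theta_ofReal (by positivity)]
    exact (sum_bounds he' _).1
  · filter_upwards [self_mem_nhdsWithin] with ε he
    have he' : (0:ℝ) < ε := he
    have hk : (0:ℝ) ≤ m ε * ε := by positivity
    simp only [Function.comp]
    rw [← ENNReal.ofReal_add hk he'.le, theta_ofReal (by positivity), theta_ofReal he'.le,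
      ← intervalIntegral.integral_add_adjacent_intervals (aux_ii le_rfl he'.le)
      (aux_ii (b := m ε * ε + ε) he'.le (by linarith)), add_sub_cancel_left]
    exact (sum_bounds he' _).2
end

section
/- Fix an integer x ≥ 1 and a real l > 0 with lx an integer. Let the people graph be the Erdős–Rényi graph with edge probability p on vertex set Z_n, where n > (l+2)x, let I ⊆ Z_n be an interval of length lx, and suppose t := px ∈ (0, 1/(l+2)). Then P(I is NOT x-good) ≤ exp[ −(t/(2p)) · ( 2l·log(√(1 + l/t) − 1) + (l² + 4l + 2)t − 2t·√(1 + l/t) − 2l·log l − l ) ]. -/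
open MeasureTheory Filter Topology

namespace Jigsaw

lemma chernoff_er {V : Type*} [Fintype V] [DecidableEq V] (p : ℝ) (hp0 : 0 ≤ p) (hp1 : p ≤ 1)
    (c : Sym2 V → ℕ) (s : ℝ) (hs : 1 ≤ s) (N : ℕ) (S : Set (Sym2 V → Bool))
    (hS : ∀ ω ∈ S, N ≤ ∑ e, if ω e then c e else 0) :
    (erMeasure V p).real S * s ^ N ≤ Real.exp (p * ∑ e, (s ^ (c e) - 1)) := by
  have hs0 : 0 < s := by linarith
  haveI : IsProbabilityMeasure (erMeasure V p) := by unfold erMeasure; infer_instance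
  have hint : ∀ f : (Sym2 V → Bool) → ℝ, Integrable f (erMeasure V p) := fun f => .of_finite
  let F : (Sym2 V → Bool) → ℝ := fun ω => ∏ e, (if ω e then s ^ (c e) else 1)
  have hF : ∀ ω, F ω = s ^ (∑ e, if ω e then c e else 0) := by
    intro ω
    simp only [F, ← Finset.prod_pow_eq_pow_sum]
    refine Finset.prod_congr rfl fun e _ => ?_
    split_ifs <;> simp
  have h1 : (erMeasure V p).real S * s ^ N ≤ ∫ ω, F ω ∂(erMeasure V p) := by
    have hm := mul_meas_ge_le_integral_of_nonneg (μ := erMeasure V p) (f := F)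
      (Filter.Eventually.of_forall fun ω => by
        show 0 ≤ F ω
        rw [hF]; positivity) (hint F) (s ^ N)
    refine le_trans ?_ hm
    rw [mul_comm]
    refine mul_le_mul_of_nonneg_left ?_ (by positivity)
    refine measureReal_mono ?_
    intro ω hω
    show s ^ N ≤ F ω
    rw [hF]
    exact pow_le_pow_right₀ hs (hS ω hω)
  refine h1.trans ?_
  have h2 : ∫ ω, F ω ∂(erMeasure V p) = ∏ e, (1 + p * (s ^ (c e) - 1)) := by
    unfold erMeasure
    rw [integral_fintype_prod_eq_prod (𝕜 := ℝ)
      (f := fun (e : Sym2 V) (b : Bool) => if b then s ^ (c e) else (1:ℝ))]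
    refine Finset.prod_congr rfl fun e _ => ?_
    rw [PMF.integral_eq_sum]
    have hq : min (Real.toNNReal p) 1 = Real.toNNReal p := by simpa using hp1
    simp [PMF.bernoulli, PMF.ofFintype_apply, hq, hp0, ENNReal.toReal_sub_of_le, hp1]
    ring
  rw [h2, Finset.mul_sum, Real.exp_sum]
  refine Finset.prod_le_prod (fun e _ => ?_) (fun e _ => ?_)
  · have := one_le_pow₀ hs (n := c e)
    have : 0 ≤ p * (s ^ (c e) - 1) := mul_nonneg hp0 (by linarith)
    linarith
  · have := Real.add_one_le_exp (p * (s ^ (c e) - 1))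
    linarith

/-- the pairs inside `I` -/
def inPairs {V : Type*} [DecidableEq V] (I : Finset V) : Finset (Sym2 V) :=
  I.offDiag.image (fun q => s(q.1, q.2))

/-- the pairs between `I` and `K` -/
def outPairs {V : Type*} [DecidableEq V] (I K : Finset V) : Finset (Sym2 V) :=
  (I ×ˢ K).image (fun q => s(q.1, q.2))

/-- multiplicity of a pair -/
def mult {V : Type*} [DecidableEq V] (I K : Finset V) (e : Sym2 V) : ℕ :=
  if e ∈ inPairs I then 2 else if e ∈ outPairs I K then 1 else 0

lemma sum_mult_le {V : Type*} [Fintype V] [DecidableEq V] (I K : Finset V) (s : ℝ) (hs : 1 ≤ s) :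
    ∑ e, (s ^ (mult I K e) - 1) ≤ ((I.card : ℝ) ^ 2 / 2) * (s ^ 2 - 1)
      + (I.card : ℝ) * K.card * (s - 1) := by
  have h1 : ∀ e, s ^ (mult I K e) - 1 ≤ (if e ∈ inPairs I then (s ^ 2 - 1) else 0)
      + (if e ∈ outPairs I K then (s - 1) else 0) := by
    intro e
    unfold mult
    split_ifs <;> simp <;> linarith
  refine (Finset.sum_le_sum fun e _ => h1 e).trans ?_
  rw [Finset.sum_add_distrib, ← Finset.sum_filter, ← Finset.sum_filter]
  simp only [Finset.filter_univ_mem, Finset.sum_const, nsmul_eq_mul]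
  have hin : ((inPairs I).card : ℝ) ≤ (I.card : ℝ) ^ 2 / 2 := by
    have : (inPairs I).card = I.card.choose 2 := Sym2.card_image_offDiag I
    rw [this, Nat.cast_choose_two]
    nlinarith [(Nat.cast_nonneg I.card : (0:ℝ) ≤ I.card)]
  have hout : ((outPairs I K).card : ℝ) ≤ (I.card : ℝ) * K.card := by
    have : (outPairs I K).card ≤ I.card * K.card := by
      rw [← Finset.card_product]; exact Finset.card_image_le
    exact_mod_cast this
  have : 0 ≤ s ^ 2 - 1 := by nlinarith
  gcongr

lemma card_le_sum_mult {V : Type*} [Fintype V] [DecidableEq V] (I K : Finset V)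
    (ω : Sym2 V → Bool) (h : ∀ u ∈ I, ∃ w ∈ I ∪ K, u ≠ w ∧ ω s(u, w) = true) :
    I.card ≤ ∑ e, if ω e then mult I K e else 0 := by
  have h' : ∀ u, ∃ w, u ∈ I → (w ∈ I ∪ K ∧ u ≠ w ∧ ω s(u, w) = true) := by
    intro u
    by_cases hu : u ∈ I
    · obtain ⟨w, hw, h2⟩ := h u hu
      exact ⟨w, fun _ => ⟨hw, h2⟩⟩
    · exact ⟨u, fun h => absurd h hu⟩
  choose g hg using h'
  rw [Finset.card_eq_sum_card_fiberwise (f := fun u => s(u, g u)) (t := Finset.univ)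
    (fun _ _ => Finset.mem_univ _)]
  refine Finset.sum_le_sum fun e _ => ?_
  rcases Finset.eq_empty_or_nonempty ({u ∈ I | s(u, g u) = e}) with he | ⟨u, hu⟩
  · rw [he]; simp
  rw [Finset.mem_filter] at hu
  obtain ⟨huI, rfl⟩ := hu
  obtain ⟨hw, hne, hω⟩ := hg u huI
  rw [if_pos hω]
  have hsub : ({v ∈ I | s(v, g v) = s(u, g u)}) ⊆ ({u, g u} : Finset V) := by
    intro v hv
    rw [Finset.mem_filter, Sym2.eq_iff] at hv
    rcases hv.2 with h | h <;> simp [h.1]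
  unfold mult
  split_ifs with h1 h2
  · exact (Finset.card_le_card hsub).trans Finset.card_le_two
  · have hnI : g u ∉ I := by
      intro hI
      exact h1 (Finset.mem_image.2 ⟨(u, g u), by simp [huI, hI, hne], rfl⟩)
    rw [Finset.card_le_one]
    have key : ∀ v ∈ ({v ∈ I | s(v, g v) = s(u, g u)} : Finset V), v = u := by
      intro v hv
      have h3 := hsub hv
      rw [Finset.mem_insert, Finset.mem_singleton] at h3
      rcases h3 with h3 | h3
      · exact h3
      · rw [Finset.mem_filter] at hv
        exact absurd (h3 ▸ hv.1) hnI
    intro v hv w hw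
    rw [key v hv, key w hw]
  · exfalso
    rcases Finset.mem_union.1 hw with hI | hK
    · exact h1 (Finset.mem_image.2 ⟨(u, g u), by simp [huI, hI, hne], rfl⟩)
    · exact h2 (Finset.mem_image.2 ⟨(u, g u), by simp [huI, hK], rfl⟩)

lemma bound_general (x lx n : ℕ) [NeZero n] (hn : lx < n) (p : ℝ) (hp0 : 0 ≤ p) (hp1 : p ≤ 1)
    (a : ℤ) (s : ℝ) (hs : 1 ≤ s) :
    (erMeasure (ZMod n) p).real {ω | ¬ xGood (graphOf ω) x a (a + lx - 1)} * s ^ lx ≤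
      Real.exp (p * (((lx : ℝ) ^ 2 / 2) * (s ^ 2 - 1) + (lx : ℝ) * (2 * x) * (s - 1))) := by
  let I : Finset (ZMod n) := (Finset.Ico a (a + lx)).image (fun z : ℤ => (z : ZMod n))
  let K0 : Finset (ZMod n) := (Finset.Ico (a - x) a ∪ Finset.Ico (a + lx) (a + lx + x)).image
    (fun z : ℤ => (z : ZMod n))
  let K := K0 \ I
  have hI : I.card = lx := by
    have : I.card = (Finset.Ico a (a + lx)).card := by
      refine Finset.card_image_of_injOn ?_
      intro u hu v hv huv
      simp only [Finset.coe_Ico, Set.mem_Ico] at hu hv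
      have h1 := (ZMod.intCast_eq_intCast_iff_dvd_sub u v n).1 huv
      have := Int.eq_zero_of_abs_lt_dvd h1 (by rw [abs_lt]; constructor <;> omega)
      omega
    rw [this]; simp
  have hK : K.card ≤ 2 * x := by
    calc K.card ≤ K0.card := Finset.card_le_card Finset.sdiff_subset
      _ ≤ _ := Finset.card_image_le
      _ ≤ _ := Finset.card_union_le _ _
      _ = 2 * x := by simp; omega
  refine (chernoff_er p hp0 hp1 (mult I K) s hs lx _ ?_).trans ?_
  · intro ω hω
    rw [← hI]
    refine card_le_sum_mult I K ω ?_
    intro u hu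
    obtain ⟨z, hz, rfl⟩ := Finset.mem_image.1 hu
    rw [Finset.mem_Ico] at hz
    simp only [Set.mem_setOf_eq, xGood] at hω
    push Not at hω
    obtain ⟨w, hw1, hw2, hadj⟩ := hω z hz.1 (by omega)
    refine ⟨w, ?_, hadj.1, hadj.2⟩
    by_cases hwI : (w : ZMod n) ∈ I
    · exact Finset.mem_union_left _ hwI
    · refine Finset.mem_union_right _ (Finset.mem_sdiff.2 ⟨?_, hwI⟩)
      refine Finset.mem_image.2 ⟨w, ?_, rfl⟩
      have : ¬ (a ≤ w ∧ w < a + lx) := fun h =>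
        hwI (Finset.mem_image.2 ⟨w, Finset.mem_Ico.2 h, rfl⟩)
      simp only [Finset.mem_union, Finset.mem_Ico]
      omega
  · refine Real.exp_le_exp.2 (mul_le_mul_of_nonneg_left ?_ hp0)
    refine (sum_mult_le I K s hs).trans ?_
    rw [hI]
    have : (K.card : ℝ) ≤ 2 * x := by exact_mod_cast hK
    have : 0 ≤ s - 1 := by linarith
    gcongr

end Jigsaw

open MeasureTheory

/-- For an Erdős–Rényi people graph on `Z_n` and an interval `I` of
length `lx`, with `t = px ∈ (0, 1/(l+2))`, the probability that `I` is not `x`-good is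
at most the stated exponential bound. -/
theorem prob_not_xGood_le (x : ℕ) (hx : 1 ≤ x) (l : ℝ) (hl : 0 < l)
    (lx : ℕ) (hlx : (lx : ℝ) = l * x) (n : ℕ) [NeZero n] (hn : (l + 2) * x < (n : ℝ))
    (p t : ℝ) (ht : t = p * x) (htt : t ∈ Set.Ioo (0 : ℝ) (1 / (l + 2))) (a : ℤ) :
    Jigsaw.erMeasure (ZMod n) p
        {ω | ¬ Jigsaw.xGood (Jigsaw.graphOf ω) x a (a + lx - 1)}
      ≤ ENNReal.ofReal (Real.exp (-(t / (2 * p)) *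
          (2 * l * Real.log (Real.sqrt (1 + l / t) - 1) + (l ^ 2 + 4 * l + 2) * t -
            2 * t * Real.sqrt (1 + l / t) - 2 * l * Real.log l - l))) := by
  obtain ⟨ht0, ht1⟩ := htt
  have hx1 : (1 : ℝ) ≤ x := by exact_mod_cast hx
  have hx0 : (0 : ℝ) < x := by linarith
  have hp0 : 0 < p := by
    by_contra h
    have : p * x ≤ 0 := mul_nonpos_of_nonpos_of_nonneg (not_lt.1 h) hx0.le
    linarith
  have hl2 : t * (l + 2) < 1 := by rwa [lt_div_iff₀ (by linarith)] at ht1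
  have hp1 : p ≤ 1 := by nlinarith
  have hn' : lx < n := by
    have : (lx : ℝ) < n := by rw [hlx]; nlinarith
    exact_mod_cast this
  set r := Real.sqrt (1 + l / t) with hr
  have hr2 : r ^ 2 = 1 + l / t := Real.sq_sqrt (by positivity)
  have hr2' : t * r ^ 2 = t + l := by rw [hr2]; field_simp
  have hrl : 1 + l ≤ r := by
    refine Real.le_sqrt_of_sq_le ?_
    have : l * (l + 2) ≤ l / t := by
      rw [le_div_iff₀ ht0]; nlinarith
    nlinarith
  have hs : 1 ≤ (r - 1) / l := by rw [le_div_iff₀ hl]; linarith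
  have main := Jigsaw.bound_general x lx n hn' p hp0.le hp1 a ((r - 1) / l) hs
  set s := (r - 1) / l with hsdef
  have hs0 : 0 < s := by linarith
  haveI : IsProbabilityMeasure (Jigsaw.erMeasure (ZMod n) p) := by
    unfold Jigsaw.erMeasure; infer_instance
  rw [← ofReal_measureReal]
  refine ENNReal.ofReal_le_ofReal ?_
  have hpow : s ^ lx = Real.exp (lx * Real.log s) := by
    rw [mul_comm, Real.exp_mul, Real.exp_log hs0, Real.rpow_natCast]
  rw [hpow, ← le_div_iff₀ (Real.exp_pos _), ← Real.exp_sub] at main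
  refine main.trans (le_of_eq ?_)
  congr 1
  have hlog : Real.log (r - 1) = Real.log s + Real.log l := by
    rw [← Real.log_mul hs0.ne' hl.ne', hsdef]; congr 1; field_simp
  have hrs : r = l * s + 1 := by rw [hsdef]; field_simp; ring
  have htp : t / (2 * p) = x / 2 := by rw [ht]; field_simp
  rw [hlog, htp, hlx, hrs]
  have hq : l * t * s ^ 2 + 2 * t * s = 1 := by
    rw [hrs] at hr2'
    have : l * (l * t * s ^ 2 + 2 * t * s) = l * 1 := by linarith
    exact mul_left_cancel₀ hl.ne' this
  have hpx : p * (((l * x) ^ 2 / 2) * (s ^ 2 - 1) + (l * x) * (2 * x) * (s - 1))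
      = x / 2 * (l ^ 2 * t * (s ^ 2 - 1) + 4 * l * t * (s - 1)) := by
    rw [ht]; ring
  rw [hpx]
  linear_combination (x * l / 2) * hq
end
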